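/- (Main theorem) Let F be a cellular automaton on a closed σ-invariant set X ⊆ A^ℤ and μ a σ-ergodic and F-invariant Borel probability measure. Then h_μ(F) ≤ h_μ(σ) · (I_μ⁺ + I_μ⁻). -/

import Mathlib

open MeasureTheory Filter Topology Set

noncomputable section

/-- The shift map `σ` on `ℤ → A`, defined by `(σ x) i = x (i + 1)`. -/
def shiftMap (A : Type*) : (ℤ → A) → (ℤ → A) := fun x i => x (i + 1)

/-- The iterate `σ^j` of the shift, for `j : ℤ`: `(σ^j x) i = x (i + j)`. -/
def shiftIter {A : Type*} (j : ℤ) (x : ℤ → A) : ℤ → A := fun i => x (i + j)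

/-- `F` admits a local rule of radius `r`:
`F(x)_i = f (x_{i-r}, …, x_{i+r})` for a block map `f : A^{2r+1} → A`. -/
def HasLocalRule {A : Type*} (F : (ℤ → A) → (ℤ → A)) (r : ℕ) : Prop :=
  ∃ f : (Fin (2 * r + 1) → A) → A, ∀ (x : ℤ → A) (i : ℤ),
    F x i = f fun j => x (i - (r : ℤ) + ((j : ℕ) : ℤ))

/-- `W_s⁺(x) = {y ∈ X : y_i = x_i for all i ≥ s}`. -/
def Wplus {A : Type*} (X : Set (ℤ → A)) (s : ℤ) (x : ℤ → A) : Set (ℤ → A) :=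
  {y ∈ X | ∀ i : ℤ, s ≤ i → y i = x i}

/-- `W_s⁻(x) = {y ∈ X : y_i = x_i for all i ≤ s}`. -/
def Wminus {A : Type*} (X : Set (ℤ → A)) (s : ℤ) (x : ℤ → A) : Set (ℤ → A) :=
  {y ∈ X | ∀ i : ℤ, i ≤ s → y i = x i}

/-- `Λ̃ₙ⁺(x) = min{s ≥ 0 : F^i(W₀⁺(x)) ⊆ W_s⁺(F^i(x)) for all 1 ≤ i ≤ n}`. -/
def lamTildeP {A : Type*} (X : Set (ℤ → A)) (F : (ℤ → A) → (ℤ → A)) (n : ℕ)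
    (x : ℤ → A) : ℕ :=
  sInf {s : ℕ | ∀ i : ℕ, 1 ≤ i → i ≤ n →
    F^[i] '' Wplus X 0 x ⊆ Wplus X (s : ℤ) (F^[i] x)}

/-- `Λ̃ₙ⁻(x) = min{s ≥ 0 : F^i(W₀⁻(x)) ⊆ W_{-s}⁻(F^i(x)) for all 1 ≤ i ≤ n}`. -/
def lamTildeM {A : Type*} (X : Set (ℤ → A)) (F : (ℤ → A) → (ℤ → A)) (n : ℕ)
    (x : ℤ → A) : ℕ :=
  sInf {s : ℕ | ∀ i : ℕ, 1 ≤ i → i ≤ n →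
    F^[i] '' Wminus X 0 x ⊆ Wminus X (-(s : ℤ)) (F^[i] x)}

/-- `Λₙ⁺(x) = max_{j ∈ ℤ} Λ̃ₙ⁺(σ^j x)`. -/
def lamP {A : Type*} (X : Set (ℤ → A)) (F : (ℤ → A) → (ℤ → A)) (n : ℕ)
    (x : ℤ → A) : ℕ :=
  sSup (Set.range fun j : ℤ => lamTildeP X F n (shiftIter j x))

/-- `Λₙ⁻(x) = max_{j ∈ ℤ} Λ̃ₙ⁻(σ^j x)`. -/
def lamM {A : Type*} (X : Set (ℤ → A)) (F : (ℤ → A) → (ℤ → A)) (n : ℕ)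
    (x : ℤ → A) : ℕ :=
  sSup (Set.range fun j : ℤ => lamTildeM X F n (shiftIter j x))

/-- `Iₙ⁺(x) = min{s ≥ 0 : F^i(W_{-s}⁺(x)) ⊆ W₀⁺(F^i(x)) for all 1 ≤ i ≤ n}`. -/
def Iplus {A : Type*} (X : Set (ℤ → A)) (F : (ℤ → A) → (ℤ → A)) (n : ℕ)
    (x : ℤ → A) : ℕ :=
  sInf {s : ℕ | ∀ i : ℕ, 1 ≤ i → i ≤ n →
    F^[i] '' Wplus X (-(s : ℤ)) x ⊆ Wplus X 0 (F^[i] x)}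

/-- `Iₙ⁻(x) = min{s ≥ 0 : F^i(W_s⁻(x)) ⊆ W₀⁻(F^i(x)) for all 1 ≤ i ≤ n}`. -/
def Iminus {A : Type*} (X : Set (ℤ → A)) (F : (ℤ → A) → (ℤ → A)) (n : ℕ)
    (x : ℤ → A) : ℕ :=
  sInf {s : ℕ | ∀ i : ℕ, 1 ≤ i → i ≤ n →
    F^[i] '' Wminus X (s : ℤ) x ⊆ Wminus X 0 (F^[i] x)}

/-- Average Lyapunov exponent `I_μ⁺ = liminf_n (∫ Iₙ⁺ dμ) / n`. -/
def avgIplus {A : Type*} [MeasurableSpace A] (X : Set (ℤ → A))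
    (F : (ℤ → A) → (ℤ → A)) (μ : Measure (ℤ → A)) : ℝ :=
  Filter.liminf (fun n : ℕ => (∫ x, (Iplus X F n x : ℝ) ∂μ) / n) Filter.atTop

/-- Average Lyapunov exponent `I_μ⁻ = liminf_n (∫ Iₙ⁻ dμ) / n`. -/
def avgIminus {A : Type*} [MeasurableSpace A] (X : Set (ℤ → A))
    (F : (ℤ → A) → (ℤ → A)) (μ : Measure (ℤ → A)) : ℝ :=
  Filter.liminf (fun n : ℕ => (∫ x, (Iminus X F n x : ℝ) ∂μ) / n) Filter.atTop

/-- The topological support `S(μ)` of a measure `μ` on `ℤ → A`. -/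
def msupp {A : Type*} [TopologicalSpace A] [MeasurableSpace A]
    (μ : Measure (ℤ → A)) : Set (ℤ → A) :=
  {x | ∀ U : Set (ℤ → A), IsOpen U → x ∈ U → 0 < μ U}

/-- `x` is an equicontinuous point of `F` on `X`: for every `ε = 2^{-m}` there is a
`δ = 2^{-k}` such that points of `X` agreeing with `x` on coordinates `|j| ≤ k`
have all their `F`-iterates agreeing with those of `x` on coordinates `|j| ≤ m`. -/
def IsEquicontPt {A : Type*} (X : Set (ℤ → A)) (F : (ℤ → A) → (ℤ → A))
    (x : ℤ → A) : Prop :=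
  ∀ m : ℕ, ∃ k : ℕ, ∀ y ∈ X, (∀ j : ℤ, |j| ≤ (k : ℤ) → y j = x j) →
    ∀ n : ℕ, ∀ j : ℤ, |j| ≤ (m : ℤ) → F^[n] y j = F^[n] x j

/-- Entropy `H_μ(α) = ∑ -μ(A) log μ(A)` of the finite partition given by the
fibers of `α`. -/
def partEnt {Ω : Type*} [MeasurableSpace Ω] (μ : Measure Ω) {I : Type*} [Fintype I]
    (α : Ω → I) : ℝ :=
  ∑ i : I, Real.negMulLog (μ (α ⁻¹' {i})).toReal

/-- Metric entropy `h_μ(T, α)` of `T` relative to the finite partition `α`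
(the limit of the subadditive sequence `H_μ(α ∨ T⁻¹α ∨ … ∨ T^{-n}α)/(n+1)`
equals its infimum). -/
def entropyPart {Ω : Type*} [MeasurableSpace Ω] (μ : Measure Ω) (T : Ω → Ω)
    {k : ℕ} (α : Ω → Fin k) : ℝ :=
  ⨅ n : ℕ, partEnt μ (fun x (i : Fin (n + 1)) => α (T^[(i : ℕ)] x)) / (n + 1)

/-- Kolmogorov–Sinai metric entropy `h_μ(T)`: supremum of `h_μ(T, α)` over all
finite measurable partitions `α`. -/
def metricEntropy {Ω : Type*} [MeasurableSpace Ω] (μ : Measure Ω) (T : Ω → Ω) : ℝ :=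
  ⨆ p : {q : Σ k : ℕ, Ω → Fin k // Measurable q.2}, entropyPart μ T p.1.2

/-- `B ∈ A^{2k+1}` is a blocking word for `F` (with radius `r`): there are `i` with
`2i+1 ≥ r` and words `vₙ ∈ A^{2i+1}`, independent of `x`, such that every `x ∈ X`
with `x(-k,k) = B` satisfies `F^n(x)(-i,i) = vₙ` for all `n ≥ 1`. -/
def IsBlockingWord {A : Type*} (X : Set (ℤ → A)) (F : (ℤ → A) → (ℤ → A)) (r k : ℕ)
    (B : Fin (2 * k + 1) → A) : Prop :=
  ∃ i : ℕ, r ≤ 2 * i + 1 ∧ ∃ v : ℕ → Fin (2 * i + 1) → A,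
    ∀ x ∈ X, (∀ j : Fin (2 * k + 1), x (((j : ℕ) : ℤ) - (k : ℤ)) = B j) →
      ∀ n : ℕ, 1 ≤ n → ∀ j : Fin (2 * i + 1),
        F^[n] x (((j : ℕ) : ℤ) - (i : ℤ)) = v n j

/-- `D(n, 2^{-p})`: minimal cardinality of an `(n, 2^{-p})`-covering (spanning) set
for `F`, where closeness in the Bowen metric `d_n` up to `2^{-p}` means agreement of
all iterates `F^i`, `i ≤ n`, on the coordinates `|j| ≤ p`. -/
def coverNum {A : Type*} (F : (ℤ → A) → (ℤ → A)) (n p : ℕ) : ℕ :=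
  sInf {N : ℕ | ∃ S : Finset (ℤ → A), S.card ≤ N ∧ ∀ x : ℤ → A, ∃ y ∈ S,
    ∀ i : ℕ, i ≤ n → ∀ j : ℤ, |j| ≤ (p : ℤ) → F^[i] x j = F^[i] y j}

/-- Topological entropy `h_top(F) = lim_{ε→0} lim_n (1/n) log D(n, ε)`. -/
def htop {A : Type*} (F : (ℤ → A) → (ℤ → A)) : ℝ :=
  ⨆ p : ℕ, Filter.limsup (fun n : ℕ => Real.log (coverNum F n p) / n) Filter.atTop

end

section FiniteEntropy

variable {Ω Ω' : Type*} [MeasurableSpace Ω] [MeasurableSpace Ω']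
  {S T R S' : Type*}

/-- A map into a (finite) type all of whose fibers are measurable. -/
def FiberMeas (α : Ω → S) : Prop := ∀ s, MeasurableSet (α ⁻¹' {s})

/-- The value of `β` determines the value of `α`. -/
def Determines {Ω : Type*} (β : Ω → T) (α : Ω → S) : Prop := ∀ x y, β x = β y → α x = α y

/-- Conditional entropy `H(α | γ) = H(α, γ) - H(γ)`. -/
noncomputable def condEnt [Fintype S] [Fintype T] (μ : Measure Ω) (α : Ω → S) (γ : Ω → T) : ℝ :=
  partEnt μ (fun x => (α x, γ x)) - partEnt μ γ

theorem FiberMeas.preimage [Finite S] {α : Ω → S} (hα : FiberMeas α) (s : Set S) :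
    MeasurableSet (α ⁻¹' s) := by
  rw [← biUnion_preimage_singleton]
  exact s.toFinite.measurableSet_biUnion fun i _ => hα i

theorem FiberMeas.comp [Finite S] {α : Ω → S} (hα : FiberMeas α) (f : S → T) :
    FiberMeas (fun x => f (α x)) :=
  fun t => hα.preimage (f ⁻¹' {t})

theorem FiberMeas.of_determines [Finite T] {β : Ω → T} {α : Ω → S} (hβ : FiberMeas β)
    (h : Determines β α) : FiberMeas α := by
  intro s
  have : α ⁻¹' {s} = β ⁻¹' (β '' (α ⁻¹' {s})) := by
    ext x
    constructor
    · exact fun hx => ⟨x, hx, rfl⟩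
    · rintro ⟨y, hy, hxy⟩
      simpa [← h _ _ hxy] using hy
  rw [this]
  exact hβ.preimage _

theorem FiberMeas.prodMk {α : Ω → S} {β : Ω → T} (hα : FiberMeas α) (hβ : FiberMeas β) :
    FiberMeas (fun x => (α x, β x)) := by
  rintro ⟨s, t⟩
  have : (fun x => (α x, β x)) ⁻¹' {(s, t)} = α ⁻¹' {s} ∩ β ⁻¹' {t} := by
    ext x; simp
  rw [this]
  exact (hα s).inter (hβ t)

theorem FiberMeas.pi {ι : Type*} [Countable ι] {S : ι → Type*} {α : ∀ i, Ω → S i}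
    (hα : ∀ i, FiberMeas (α i)) : FiberMeas (fun x i => α i x) := by
  intro s
  have : (fun x i => α i x) ⁻¹' {s} = ⋂ i, α i ⁻¹' {s i} := by
    ext x; simp [funext_iff]
  rw [this]
  exact MeasurableSet.iInter fun i => hα i _

theorem FiberMeas.comp_measurable {α : Ω' → S} (hα : FiberMeas α) {f : Ω → Ω'}
    (hf : Measurable f) : FiberMeas (fun x => α (f x)) :=
  fun s => hf (hα s)

theorem Measurable.fiberMeas [MeasurableSpace S] [MeasurableSingletonClass S] {α : Ω → S}
    (hα : Measurable α) : FiberMeas α :=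
  fun s => hα (measurableSet_singleton s)

variable [Fintype S] [Fintype T] [Fintype R] [Fintype S']

theorem FiberMeas.comp_eq_sum_indicator (α : Ω → S) (φ : S → ℝ) :
    (fun x => φ (α x)) = fun x => ∑ s, (α ⁻¹' {s}).indicator (fun _ => φ s) x := by
  classical
  ext x
  simp [Set.indicator_apply]

theorem FiberMeas.measurable_comp {α : Ω → S} (hα : FiberMeas α) (φ : S → ℝ) :
    Measurable (fun x => φ (α x)) := by
  rw [FiberMeas.comp_eq_sum_indicator]
  exact Finset.measurable_sum _ fun s _ => measurable_const.indicator (hα s)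

section Prob

variable (μ : Measure Ω) [IsProbabilityMeasure μ]

theorem FiberMeas.integrable_comp {α : Ω → S} (hα : FiberMeas α) (φ : S → ℝ) :
    Integrable (fun x => φ (α x)) μ := by
  rw [FiberMeas.comp_eq_sum_indicator]
  exact integrable_finsetSum _ fun s _ => (integrable_const _).indicator (hα s)

theorem FiberMeas.integral_comp {α : Ω → S} (hα : FiberMeas α) (φ : S → ℝ) :
    ∫ x, φ (α x) ∂μ = ∑ s, μ.real (α ⁻¹' {s}) * φ s := by
  rw [FiberMeas.comp_eq_sum_indicator, integral_finsetSum]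
  · refine Finset.sum_congr rfl fun s _ => ?_
    rw [integral_indicator_const _ (hα s), smul_eq_mul]
  · exact fun s _ => (integrable_const _).indicator (hα s)

theorem FiberMeas.sum_real {α : Ω → S} (hα : FiberMeas α) :
    ∑ s, μ.real (α ⁻¹' {s}) = 1 := by
  simpa using (hα.integral_comp μ (fun _ => 1)).symm

theorem FiberMeas.sum_real_prodMk {α : Ω → S} {β : Ω → T} (hα : FiberMeas α) (hβ : FiberMeas β)
    (t : T) : ∑ s, μ.real ((fun x => (α x, β x)) ⁻¹' {(s, t)}) = μ.real (β ⁻¹' {t}) := by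
  have : ∀ s, (fun x => (α x, β x)) ⁻¹' {(s, t)} = β ⁻¹' {t} ∩ α ⁻¹' {s} := by
    intro s; ext x; simp [and_comm]
  simp_rw [this]
  rw [← measureReal_biUnion_finset]
  · congr 1; ext x; simp
  · intro s _ s' _ hss
    refine Set.disjoint_left.2 fun x hx hx' => hss ?_
    rw [← hx.2, ← hx'.2]
  · exact fun s _ => (hβ t).inter (hα s)

theorem partEnt_eq_integral {α : Ω → S} (hα : FiberMeas α) :
    partEnt μ α = ∫ x, -Real.log (μ.real (α ⁻¹' {α x})) ∂μ := by
  rw [hα.integral_comp μ (fun s => -Real.log (μ.real (α ⁻¹' {s})))]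
  refine Finset.sum_congr rfl fun s _ => ?_
  simp [Real.negMulLog, Measure.real]

theorem FiberMeas.ae_real_pos {α : Ω → S} :
    ∀ᵐ x ∂μ, 0 < μ.real (α ⁻¹' {α x}) := by
  have : ∀ s : S, ∀ᵐ x ∂μ, α x = s → 0 < μ.real (α ⁻¹' {s}) := by
    intro s
    by_cases h : μ (α ⁻¹' {s}) = 0
    · have := measure_eq_zero_iff_ae_notMem.1 h
      filter_upwards [this] with x hx hxs
      exact absurd hxs hx
    · exact Eventually.of_forall fun x _ =>
        ENNReal.toReal_pos h (measure_ne_top _ _)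
  filter_upwards [ae_all_iff.2 this] with x hx
  exact hx _ rfl

theorem partEnt_le_integral_neg_log {α : Ω → S} (hα : FiberMeas α) (Q : S → ℝ)
    (hQ0 : ∀ s, 0 ≤ Q s) (hQ1 : ∑ s, Q s ≤ 1) (hpos : ∀ᵐ x ∂μ, 0 < Q (α x)) :
    partEnt μ α ≤ ∫ x, -Real.log (Q (α x)) ∂μ := by
  rw [hα.integral_comp μ (fun s => -Real.log (Q s))]
  have key : ∀ s, Real.negMulLog (μ (α ⁻¹' {s})).toReal ≤
      μ.real (α ⁻¹' {s}) * (-Real.log (Q s)) + (Q s - μ.real (α ⁻¹' {s})) := by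
    intro s
    change Real.negMulLog (μ.real (α ⁻¹' {s})) ≤ _
    rcases (measureReal_nonneg (μ := μ) (s := α ⁻¹' {s})).eq_or_lt with h0 | h0
    · rw [← h0]; simpa using hQ0 s
    · have hQ : 0 < Q s := by
        by_contra hQ
        have : μ (α ⁻¹' {s}) = 0 := by
          refine measure_eq_zero_iff_ae_notMem.2 ?_
          filter_upwards [hpos] with x hx hxs
          rw [mem_preimage, mem_singleton_iff] at hxs
          exact hQ (hxs ▸ hx)
        simp [Measure.real, this] at h0
      have := Real.log_le_sub_one_of_pos (div_pos hQ h0)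
      rw [Real.log_div hQ.ne' h0.ne'] at this
      have h2 := mul_le_mul_of_nonneg_left this h0.le
      have h3 : μ.real (α ⁻¹' {s}) * (Q s / μ.real (α ⁻¹' {s}) - 1) =
          Q s - μ.real (α ⁻¹' {s}) := by field_simp
      rw [h3] at h2
      unfold Real.negMulLog
      nlinarith
  calc partEnt μ α ≤ ∑ s, (μ.real (α ⁻¹' {s}) * (-Real.log (Q s)) +
        (Q s - μ.real (α ⁻¹' {s}))) := Finset.sum_le_sum fun s _ => key s
    _ ≤ _ := by
      rw [Finset.sum_add_distrib, Finset.sum_sub_distrib, hα.sum_real μ]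
      linarith

theorem partEnt_le_of_determines {α : Ω → S} {β : Ω → T} (hβ : FiberMeas β)
    (h : Determines β α) : partEnt μ α ≤ partEnt μ β := by
  have hα := hβ.of_determines h
  rw [partEnt_eq_integral μ hα, partEnt_eq_integral μ hβ]
  refine integral_mono_ae
    (hα.integrable_comp μ (fun s => -Real.log (μ.real (α ⁻¹' {s}))))
    (hβ.integrable_comp μ (fun s => -Real.log (μ.real (β ⁻¹' {s})))) ?_
  filter_upwards [FiberMeas.ae_real_pos μ (α := β)] with x hx
  refine neg_le_neg (Real.log_le_log hx (measureReal_mono ?_))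
  exact fun y hy => h _ _ hy

theorem partEnt_le_log_card [Nonempty S] {α : Ω → S} (hα : FiberMeas α) :
    partEnt μ α ≤ Real.log (Fintype.card S) := by
  have hc : (0 : ℝ) < Fintype.card S := by exact_mod_cast Fintype.card_pos
  refine (partEnt_le_integral_neg_log μ hα (fun _ => (Fintype.card S : ℝ)⁻¹)
    (fun _ => (inv_pos.2 hc).le) ?_ (Eventually.of_forall fun _ => inv_pos.2 hc)).trans ?_
  · simp [hc.ne']
  · simp

theorem partEnt_nonneg (α : Ω → S) : 0 ≤ partEnt μ α :=
  Finset.sum_nonneg fun _ _ => Real.negMulLog_nonneg measureReal_nonneg measureReal_le_one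

theorem partEnt_submodular {α : Ω → S} {β : Ω → T} {γ : Ω → R} (hα : FiberMeas α)
    (hβ : FiberMeas β) (hγ : FiberMeas γ) :
    partEnt μ (fun x => (α x, β x, γ x)) + partEnt μ γ ≤
      partEnt μ (fun x => (α x, γ x)) + partEnt μ (fun x => (β x, γ x)) := by
  have hαγ := hα.prodMk hγ
  have hβγ := hβ.prodMk hγ
  set p : R → ℝ := fun c => μ.real (γ ⁻¹' {c}) with hp
  set pa : S × R → ℝ := fun c => μ.real ((fun x => (α x, γ x)) ⁻¹' {c}) with hpa
  set pb : T × R → ℝ := fun c => μ.real ((fun x => (β x, γ x)) ⁻¹' {c}) with hpb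
  have hae := FiberMeas.ae_real_pos μ (α := γ)
  have haea := FiberMeas.ae_real_pos μ (α := fun x => (α x, γ x))
  have haeb := FiberMeas.ae_real_pos μ (α := fun x => (β x, γ x))
  have key := partEnt_le_integral_neg_log μ (hα.prodMk hβγ)
    (fun w => pa (w.1, w.2.2) * pb (w.2.1, w.2.2) / p w.2.2)
    (fun w => by positivity) ?_ ?_
  · have e : ∫ x, -Real.log (pa (α x, γ x) * pb (β x, γ x) / p (γ x)) ∂μ =
        ∫ x, ((-Real.log (pa (α x, γ x)) + -Real.log (pb (β x, γ x))) - (-Real.log (p (γ x)))) ∂μ := by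
      refine integral_congr_ae ?_
      filter_upwards [hae, haea, haeb] with x h1 h2 h3
      change 0 < p (γ x) at h1
      change 0 < pa (α x, γ x) at h2
      change 0 < pb (β x, γ x) at h3
      rw [Real.log_div (mul_pos h2 h3).ne' h1.ne', Real.log_mul h2.ne' h3.ne']
      ring
    rw [e, integral_sub, integral_add] at key
    · rw [partEnt_eq_integral μ hγ, partEnt_eq_integral μ hαγ, partEnt_eq_integral μ hβγ]
      linarith
    · exact hαγ.integrable_comp μ (fun w => -Real.log (pa w))
    · exact hβγ.integrable_comp μ (fun w => -Real.log (pb w))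
    · exact (hαγ.integrable_comp μ (fun w => -Real.log (pa w))).add
        (hβγ.integrable_comp μ (fun w => -Real.log (pb w)))
    · exact hγ.integrable_comp μ (fun w => -Real.log (p w))
  · rw [Fintype.sum_prod_type]
    simp_rw [Fintype.sum_prod_type]
    rw [Finset.sum_comm' (t' := Finset.univ) (s' := fun _ => Finset.univ) (by simp)]
    have h1 : ∀ t : T, ∑ s : S, ∑ c : R, pa (s, c) * pb (t, c) / p c =
        ∑ c : R, pb (t, c) := by
      intro t
      rw [Finset.sum_comm]
      refine Finset.sum_congr rfl fun c _ => ?_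
      rw [← Finset.sum_div, ← Finset.sum_mul]
      have : ∑ s, pa (s, c) = p c := hα.sum_real_prodMk μ hγ c
      rw [this]
      by_cases h : p c = 0
      · have h2 : pb (t, c) ≤ p c := measureReal_mono fun x hx => by
          simp only [mem_preimage, mem_singleton_iff, Prod.mk.injEq] at hx
          exact hx.2
        have h3 : 0 ≤ pb (t, c) := measureReal_nonneg
        have : pb (t, c) = 0 := by linarith
        simp [this]
      · field_simp
    simp_rw [h1]
    rw [← Fintype.sum_prod_type (f := pb)]
    exact (hβγ.sum_real μ).le
  · filter_upwards [hae, haea, haeb] with x h1 h2 h3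
    exact div_pos (mul_pos h2 h3) h1

theorem partEnt_congr {α : Ω → S} {β : Ω → T} (hβ : FiberMeas β)
    (h : Determines β α) (h' : Determines α β) : partEnt μ α = partEnt μ β :=
  le_antisymm (partEnt_le_of_determines μ hβ h)
    (partEnt_le_of_determines μ (hβ.of_determines h) h')

theorem condEnt_le_of_determines_right {α : Ω → S} {γ : Ω → T} {γ' : Ω → R} (hα : FiberMeas α)
    (hγ' : FiberMeas γ') (h : Determines γ' γ) : condEnt μ α γ' ≤ condEnt μ α γ := by
  have hγ := hγ'.of_determines h
  have h1 := partEnt_submodular μ hα hγ' hγ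
  have h2 : partEnt μ (fun x => (γ' x, γ x)) ≤ partEnt μ γ' :=
    partEnt_le_of_determines μ hγ' fun x y hxy => Prod.ext hxy (h _ _ hxy)
  have h3 : partEnt μ (fun x => (α x, γ' x)) ≤ partEnt μ (fun x => (α x, γ' x, γ x)) :=
    partEnt_le_of_determines μ (hα.prodMk (hγ'.prodMk hγ)) fun x y hxy => by
      simp only [Prod.mk.injEq] at hxy ⊢
      exact ⟨hxy.1, hxy.2.1⟩
  unfold condEnt
  linarith

theorem condEnt_le_of_determines_left {α : Ω → S} {α' : Ω → S'} {γ : Ω → T}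
    (hα' : FiberMeas α') (hγ : FiberMeas γ) (h : Determines (fun x => (α' x, γ x)) α) :
    condEnt μ α γ ≤ condEnt μ α' γ := by
  have : partEnt μ (fun x => (α x, γ x)) ≤ partEnt μ (fun x => (α' x, γ x)) :=
    partEnt_le_of_determines μ (hα'.prodMk hγ) fun x y hxy =>
      Prod.ext (h _ _ hxy) (Prod.ext_iff.1 hxy).2
  exact sub_le_sub_right this _

theorem condEnt_chain {α : Ω → S} {β : Ω → T} {γ : Ω → R} (hα : FiberMeas α)
    (hβ : FiberMeas β) (hγ : FiberMeas γ) :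
    condEnt μ (fun x => (α x, β x)) γ = condEnt μ α γ + condEnt μ β (fun x => (α x, γ x)) := by
  have : partEnt μ (fun x => ((α x, β x), γ x)) = partEnt μ (fun x => (β x, α x, γ x)) :=
    partEnt_congr μ (hβ.prodMk (hα.prodMk hγ)) (fun x y h => by simp_all)
      (fun x y h => by simp_all)
  unfold condEnt
  rw [this]
  ring

theorem partEnt_prodMk_le {α : Ω → S} {β : Ω → T} (hα : FiberMeas α) (hβ : FiberMeas β) :
    partEnt μ (fun x => (α x, β x)) ≤ partEnt μ α + partEnt μ β := by
  have hu : FiberMeas (fun _ : Ω => ()) := fun s => by simp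
  have h0 : partEnt μ (fun _ : Ω => ()) = 0 := by simp [partEnt]
  have h1 := partEnt_submodular μ hα hβ hu
  have e1 : partEnt μ (fun x => (α x, β x)) ≤ partEnt μ (fun x => (α x, β x, ())) :=
    partEnt_le_of_determines μ (hα.prodMk (hβ.prodMk hu)) fun x y h => by simp_all
  have e2 : partEnt μ (fun x => (α x, ())) ≤ partEnt μ α :=
    partEnt_le_of_determines μ hα fun x y h => by simp_all
  have e3 : partEnt μ (fun x => (β x, ())) ≤ partEnt μ β :=
    partEnt_le_of_determines μ hβ fun x y h => by simp_all
  linarith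

theorem condEnt_pi_le {n : ℕ} {α : Fin n → Ω → S} {γ : Ω → T} (hα : ∀ i, FiberMeas (α i))
    (hγ : FiberMeas γ) :
    condEnt μ (fun x i => α i x) γ ≤ ∑ i, condEnt μ (α i) γ := by
  induction n with
  | zero =>
    simp only [Finset.univ_eq_empty, Finset.sum_empty]
    refine sub_nonpos.2 (partEnt_le_of_determines μ hγ fun x y h => ?_)
    exact Prod.ext (Subsingleton.elim _ _) h
  | succ n ih =>
    have hp : FiberMeas (fun x (i : Fin n) => α i.castSucc x) :=
      FiberMeas.pi fun i => hα i.castSucc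
    rw [Fin.sum_univ_castSucc]
    calc condEnt μ (fun x i => α i x) γ
        ≤ condEnt μ (fun x => ((fun i : Fin n => α i.castSucc x), α (Fin.last n) x)) γ := by
          refine condEnt_le_of_determines_left μ (hp.prodMk (hα _)) hγ fun x y h => ?_
          simp only [Prod.mk.injEq] at h
          exact funext fun i => Fin.lastCases h.1.2 (fun j => congrFun h.1.1 j) i
      _ = _ := condEnt_chain μ hp (hα _) hγ
      _ ≤ _ := add_le_add (ih fun i => hα i.castSucc)
          (condEnt_le_of_determines_right μ (hα _) (hp.prodMk hγ) fun x y h => by simp_all)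

theorem partEnt_comp {ν : Measure Ω'} {α : Ω' → S} (hα : FiberMeas α) {f : Ω → Ω'}
    (hf : MeasurePreserving f μ ν) : partEnt μ (fun x => α (f x)) = partEnt ν α := by
  refine Finset.sum_congr rfl fun s _ => ?_
  rw [← hf.measure_preimage (hα s).nullMeasurableSet]
  rfl

theorem condEnt_comp {ν : Measure Ω'} {α : Ω' → S} {γ : Ω' → T} (hα : FiberMeas α)
    (hγ : FiberMeas γ) {f : Ω → Ω'} (hf : MeasurePreserving f μ ν) :
    condEnt μ (fun x => α (f x)) (fun x => γ (f x)) = condEnt ν α γ :=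
  congrArg₂ (· - ·) (partEnt_comp μ (hα.prodMk hγ) hf) (partEnt_comp μ hγ hf)

/-- Fano-type estimate: if `γ` determines `α` on `G`, then `H(α | γ)` is controlled by the measure
of the complement of `G`. -/
theorem condEnt_le_of_determines_on [Nonempty S] {α : Ω → S} {γ : Ω → T} (hα : FiberMeas α)
    (hγ : FiberMeas γ) {G : Set Ω} (hG : MeasurableSet G)
    (h : ∀ x ∈ G, ∀ y ∈ G, γ x = γ y → α x = α y) {η : ℝ} (h0 : 0 < η) (h1 : η < 1) :
    condEnt μ α γ ≤ -Real.log (1 - η) + μ.real Gᶜ * Real.log (Fintype.card S / η) := by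
  classical
  have hc : (0 : ℝ) < Fintype.card S := by exact_mod_cast Fintype.card_pos
  have hc1 : (1 : ℝ) ≤ Fintype.card S := by exact_mod_cast Fintype.card_pos
  obtain ⟨d, hd⟩ : ∃ d : T → S, ∀ x ∈ G, d (γ x) = α x := by
    refine ⟨fun t => if ht : ∃ x ∈ G, γ x = t then α ht.choose else Classical.arbitrary S,
      fun x hx => ?_⟩
    have ht : ∃ y ∈ G, γ y = γ x := ⟨x, hx, rfl⟩
    simp only [ht, dif_pos]
    exact h _ ht.choose_spec.1 _ hx ht.choose_spec.2
  set q : S → T → ℝ := fun s t => (if s = d t then 1 - η else 0) + η / Fintype.card S with hq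
  have hηc : 0 < η / Fintype.card S := div_pos h0 hc
  have hqpos : ∀ s t, 0 < q s t := by
    intro s t
    simp only [hq]
    split_ifs <;> linarith
  have hae := FiberMeas.ae_real_pos μ (α := γ)
  have key := partEnt_le_integral_neg_log μ (hα.prodMk hγ)
    (fun w => q w.1 w.2 * μ.real (γ ⁻¹' {w.2}))
    (fun w => mul_nonneg (hqpos _ _).le measureReal_nonneg) ?_ ?_
  · have e : ∫ x, -Real.log (q (α x) (γ x) * μ.real (γ ⁻¹' {γ x})) ∂μ =
        ∫ x, (-Real.log (q (α x) (γ x)) + -Real.log (μ.real (γ ⁻¹' {γ x}))) ∂μ := by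
      refine integral_congr_ae ?_
      filter_upwards [hae] with x h1
      rw [Real.log_mul (hqpos _ _).ne' h1.ne']
      ring
    have hi : Integrable (fun x => -Real.log (q (α x) (γ x))) μ :=
      (hα.prodMk hγ).integrable_comp μ (fun w => -Real.log (q w.1 w.2))
    rw [e, integral_add hi
      (hγ.integrable_comp μ (fun w => -Real.log (μ.real (γ ⁻¹' {w}))))] at key
    have h3 : ∫ x, -Real.log (q (α x) (γ x)) ∂μ ≤
        ∫ x, (-Real.log (1 - η) + Gᶜ.indicator (fun _ => Real.log (Fintype.card S / η)) x) ∂μ := by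
      refine integral_mono hi ((integrable_const _).add
        ((integrable_const _).indicator hG.compl)) fun x => ?_
      have hl : 0 ≤ -Real.log (1 - η) := neg_nonneg.2 (Real.log_nonpos (by linarith) (by linarith))
      by_cases hx : x ∈ G
      · have : 1 - η ≤ q (α x) (γ x) := by
          simp only [hq, hd x hx, if_true]; linarith
        simpa [hx] using Real.log_le_log (by linarith) this
      · have h4 : η / Fintype.card S ≤ q (α x) (γ x) := by
          simp only [hq]; split_ifs <;> linarith
        have h5 := Real.log_le_log hηc h4
        have h6 : Real.log (Fintype.card S / η) = - Real.log (η / Fintype.card S) := by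
          rw [← Real.log_inv, inv_div]
        simp only [mem_compl_iff, hx, not_false_iff, indicator_of_mem, h6]
        linarith
    rw [integral_add (integrable_const _) ((integrable_const _).indicator hG.compl),
      integral_indicator_const _ hG.compl] at h3
    simp only [integral_const, probReal_univ, smul_eq_mul, one_mul] at h3
    unfold condEnt
    rw [partEnt_eq_integral μ hγ]
    linarith
  · rw [Fintype.sum_prod_type_right]
    have : ∀ t, ∑ s, q s t = 1 := by
      intro t
      simp only [hq, Finset.sum_add_distrib, Finset.sum_ite_eq', Finset.sum_const,
        Finset.card_univ, nsmul_eq_mul, Finset.mem_univ, if_true]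
      field_simp
      ring
    simp_rw [← Finset.sum_mul, this, one_mul]
    exact (hγ.sum_real μ).le
  · filter_upwards [hae] with x hx
    exact mul_pos (hqpos _ _) hx

end Prob

theorem exists_neg_log_one_sub_add_mul_log_lt {c ε : ℝ} (hc : 1 ≤ c) (hε : 0 < ε) :
    ∃ η δ : ℝ, 0 < η ∧ η < 1 ∧ 0 < δ ∧
      ∀ m < δ, -Real.log (1 - η) + m * Real.log (c / η) < ε := by
  have he : Real.exp (-(ε / 2)) < 1 := by
    rw [← Real.exp_zero]; exact Real.exp_lt_exp.2 (by linarith)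
  have he0 := Real.exp_pos (-(ε / 2))
  have hη : 0 < 1 - Real.exp (-(ε / 2)) := by linarith
  have hL : 0 < Real.log (c / (1 - Real.exp (-(ε / 2)))) := by
    refine Real.log_pos ?_
    rw [lt_div_iff₀ hη]
    linarith
  refine ⟨1 - Real.exp (-(ε / 2)), ε / 2 / Real.log (c / (1 - Real.exp (-(ε / 2)))), hη,
    by linarith, by positivity, fun m hm => ?_⟩
  rw [lt_div_iff₀ hL] at hm
  rw [sub_sub_cancel, Real.log_exp]
  linarith

end FiniteEntropy

section Generator

theorem partEnt_iterate_le_add_condEnt {Ω S T : Type*} [MeasurableSpace Ω] [Fintype S] [Fintype T]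
    (μ : Measure Ω) [IsProbabilityMeasure μ] {f : Ω → Ω} (hf : MeasurePreserving f μ μ)
    {α : Ω → S} {β : Ω → T} (hα : FiberMeas α) (hβ : FiberMeas β) (n : ℕ) :
    partEnt μ (fun x (i : Fin (n + 1)) => β (f^[i] x)) ≤
      partEnt μ (fun x (i : Fin (n + 1)) => α (f^[i] x)) + (n + 1) * condEnt μ β α := by
  have hαi : ∀ i : Fin (n + 1), FiberMeas (fun x => α (f^[i] x)) := fun i =>
    hα.comp_measurable (hf.iterate i).measurable
  have hβi : ∀ i : Fin (n + 1), FiberMeas (fun x => β (f^[i] x)) := fun i =>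
    hβ.comp_measurable (hf.iterate i).measurable
  have h1 := condEnt_pi_le μ hβi (FiberMeas.pi hαi)
  have h2 : ∀ i : Fin (n + 1), condEnt μ (fun x => β (f^[i] x))
      (fun x (i : Fin (n + 1)) => α (f^[i] x)) ≤ condEnt μ β α := fun i => by
    rw [← condEnt_comp μ hβ hα (hf.iterate i)]
    exact condEnt_le_of_determines_right μ (hβi i) (FiberMeas.pi hαi) fun x y h => congrFun h i
  have h3 := Finset.sum_le_sum fun i (_ : i ∈ Finset.univ) => h2 i
  simp only [Finset.sum_const, Finset.card_univ, Fintype.card_fin, nsmul_eq_mul] at h3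
  push_cast at h3
  have h4 : partEnt μ (fun x (i : Fin (n + 1)) => β (f^[i] x)) ≤
      partEnt μ (fun x => ((fun i : Fin (n + 1) => β (f^[i] x)),
        (fun i : Fin (n + 1) => α (f^[i] x)))) :=
    partEnt_le_of_determines μ ((FiberMeas.pi hβi).prodMk (FiberMeas.pi hαi))
      fun x y h => (Prod.ext_iff.1 h).1
  have h5 := h1.trans h3
  unfold condEnt at h5 ⊢
  linarith

variable {A : Type*}

/-- The restriction of `x` to the coordinates `a ≤ i < b`. -/
def window (a b : ℤ) (x : ℤ → A) : Finset.Ico a b → A := fun i => x i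

theorem window_eq_iff {a b : ℤ} {x y : ℤ → A} :
    window a b x = window a b y ↔ ∀ i, a ≤ i → i < b → x i = y i := by
  constructor
  · exact fun h i h1 h2 => congrFun h ⟨i, Finset.mem_Ico.2 ⟨h1, h2⟩⟩
  · exact fun h => funext fun i => h i (Finset.mem_Ico.1 i.2).1 (Finset.mem_Ico.1 i.2).2

variable [Fintype A] [TopologicalSpace A] [DiscreteTopology A] [MeasurableSpace A] [BorelSpace A]

theorem continuous_window (a b : ℤ) : Continuous (window a b : (ℤ → A) → _) :=
  continuous_pi fun _ => continuous_apply _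

theorem fiberMeas_window (a b : ℤ) : FiberMeas (window a b : (ℤ → A) → _) :=
  (measurable_pi_lambda _ fun _ => measurable_pi_apply _ :
    Measurable (window a b : (ℤ → A) → _)).fiberMeas

theorem exists_condEnt_window_lt (μ : Measure (ℤ → A)) [IsProbabilityMeasure μ] {k : ℕ}
    {β : (ℤ → A) → Fin k} (hβ : Measurable β) {ε : ℝ} (hε : 0 < ε) :
    ∃ p : ℕ, condEnt μ β (window (-p : ℤ) p) < ε := by
  obtain ⟨x₀⟩ : Nonempty (ℤ → A) := nonempty_of_isProbabilityMeasure μ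
  have : Nonempty (Fin k) := ⟨β x₀⟩
  have hk : (1 : ℝ) ≤ Fintype.card (Fin k) := by exact_mod_cast Fintype.card_pos
  obtain ⟨η, δ, hη0, hη1, hδ, hm⟩ := exists_neg_log_one_sub_add_mul_log_lt hk hε
  have hkpos : (0 : ℝ) < k := by simpa using lt_of_lt_of_le zero_lt_one hk
  have hδk : 0 < δ / (2 * k) := by positivity
  have hK : ∀ i, ∃ K ⊆ β ⁻¹' {i}, IsClosed K ∧ μ (β ⁻¹' {i} \ K) < ENNReal.ofReal (δ / (2 * k)) :=
    fun i => (hβ (measurableSet_singleton i)).exists_isClosed_sdiff_lt (measure_ne_top _ _)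
      (ENNReal.ofReal_pos.2 hδk).ne'
  choose K hKs hKc hKm using hK
  let Z : ℕ → Set ((ℤ → A) × (ℤ → A)) := fun p =>
    (⋃ i, ⋃ j, ⋃ (_ : i ≠ j), K i ×ˢ K j) ∩
      {z | window (-p : ℤ) p z.1 = window (-p : ℤ) p z.2}
  have hZc : ∀ p, IsClosed (Z p) := fun p =>
    (isClosed_iUnion_of_finite fun i => isClosed_iUnion_of_finite fun j =>
      isClosed_iUnion_of_finite fun _ => (hKc i).prod (hKc j)).inter
      (isClosed_eq ((continuous_window _ _).comp continuous_fst)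
        ((continuous_window _ _).comp continuous_snd))
  have hZ : ∃ p, Z p = ∅ := by
    by_contra! hne
    obtain ⟨⟨x, y⟩, hxy⟩ := IsCompact.nonempty_iInter_of_sequence_nonempty_isCompact_isClosed Z
      (fun p z hz => ⟨hz.1, window_eq_iff.2 fun i h1 h2 =>
        window_eq_iff.1 hz.2 i (by push_cast; linarith) (by push_cast; linarith)⟩)
      hne (hZc 0).isCompact hZc
    rw [mem_iInter] at hxy
    have hx : x = y := funext fun i =>
      window_eq_iff.1 (hxy (i.natAbs + 1)).2 i (by omega) (by omega)
    have := (hxy 0).1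
    simp only [mem_iUnion, mem_prod] at this
    obtain ⟨i, j, hij, h1, h2⟩ := this
    refine hij ?_
    rw [← show β x = i from hKs i h1, ← show β y = j from hKs j h2, hx]
  obtain ⟨p, hp⟩ := hZ
  refine ⟨p, ?_⟩
  have hG : MeasurableSet (⋃ i, K i) := MeasurableSet.iUnion fun i => (hKc i).measurableSet
  refine (condEnt_le_of_determines_on μ hβ.fiberMeas (fiberMeas_window _ _) hG ?_ hη0 hη1).trans_lt
    (hm _ ?_)
  · intro x hx y hy hxy
    obtain ⟨i, hi⟩ := mem_iUnion.1 hx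
    obtain ⟨j, hj⟩ := mem_iUnion.1 hy
    rw [show β x = i from hKs i hi, show β y = j from hKs j hj]
    by_contra hij
    have : (x, y) ∈ Z p := ⟨mem_iUnion.2 ⟨i, mem_iUnion.2 ⟨j, mem_iUnion.2 ⟨hij, hi, hj⟩⟩⟩, hxy⟩
    rw [hp] at this
    exact this
  · have h1 : (⋃ i, K i)ᶜ ⊆ ⋃ i, β ⁻¹' {i} \ K i := fun x hx =>
      mem_iUnion.2 ⟨β x, rfl, fun h => hx (mem_iUnion.2 ⟨_, h⟩)⟩
    calc μ.real (⋃ i, K i)ᶜ ≤ μ.real (⋃ i, β ⁻¹' {i} \ K i) := measureReal_mono h1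
      _ ≤ ∑ i, μ.real (β ⁻¹' {i} \ K i) := measureReal_iUnion_fintype_le _
      _ ≤ ∑ _i : Fin k, δ / (2 * k) := Finset.sum_le_sum fun i _ =>
          ENNReal.toReal_le_of_le_ofReal hδk.le (hKm i).le
      _ = δ / 2 := by simp; field_simp
      _ < δ := by linarith

theorem entropyPart_le_of_window (μ : Measure (ℤ → A)) [IsProbabilityMeasure μ]
    {f : (ℤ → A) → (ℤ → A)} (hf : MeasurePreserving f μ μ) {B : ℝ}
    (h : ∀ p : ℕ, ∀ ε > 0, ∃ n : ℕ, partEnt μ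
      (fun x (i : Fin (n + 1)) => window (-p : ℤ) p (f^[i] x)) ≤ (n + 1) * (B + ε))
    {k : ℕ} {β : (ℤ → A) → Fin k} (hβ : Measurable β) : entropyPart μ f β ≤ B := by
  refine le_of_forall_pos_le_add fun ε hε => ?_
  obtain ⟨p, hp⟩ := exists_condEnt_window_lt μ hβ (half_pos hε)
  obtain ⟨n, hn⟩ := h p (ε / 2) (half_pos hε)
  have h1 := partEnt_iterate_le_add_condEnt μ hf (fiberMeas_window (-p : ℤ) p) hβ.fiberMeas n
  have hn0 : (0 : ℝ) < n + 1 := by positivity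
  have hbdd : BddBelow (range fun n : ℕ =>
      partEnt μ (fun x (i : Fin (n + 1)) => β (f^[(i : ℕ)] x)) / ((n : ℝ) + 1)) :=
    ⟨0, by rintro _ ⟨n, rfl⟩; exact div_nonneg (partEnt_nonneg μ _) (by positivity)⟩
  refine (ciInf_le hbdd n).trans ?_
  rw [div_le_iff₀ hn0]
  nlinarith

end Generator

section Words

variable {A : Type*}

theorem shiftIter_add (a b : ℤ) (x : ℤ → A) :
    shiftIter (a + b) x = shiftIter a (shiftIter b x) := by
  funext i
  simp [shiftIter, add_comm, add_left_comm]

theorem shiftMap_iterate (n : ℕ) (x : ℤ → A) : (shiftMap A)^[n] x = shiftIter n x := by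
  induction n with
  | zero => funext i; simp [shiftIter]
  | succ n ih =>
    rw [Function.iterate_succ_apply', ih]
    funext i
    simp [shiftIter, shiftMap, add_comm, add_left_comm]

/-- The word `x_0 … x_{n-1}`. -/
def prefixWord (n : ℕ) (x : ℤ → A) : Fin n → A := fun i => x (i : ℕ)

variable [MeasurableSpace A]

theorem measurable_shiftIter (j : ℤ) : Measurable (shiftIter j : (ℤ → A) → _) :=
  measurable_pi_lambda _ fun _ => measurable_pi_apply _

/-- The shift as a measurable equivalence. -/
def shiftEquiv (A : Type*) [MeasurableSpace A] : (ℤ → A) ≃ᵐ (ℤ → A) where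
  toFun := shiftMap A
  invFun := shiftIter (-1)
  left_inv x := by funext i; simp [shiftIter, shiftMap]
  right_inv x := by funext i; simp [shiftIter, shiftMap]
  measurable_toFun := measurable_shiftIter 1
  measurable_invFun := measurable_shiftIter (-1)

theorem measurePreserving_shiftIter {μ : Measure (ℤ → A)}
    (h : MeasurePreserving (shiftMap A) μ μ) (j : ℤ) : MeasurePreserving (shiftIter j) μ μ := by
  have hn : ∀ n : ℕ, MeasurePreserving (shiftIter (n : ℤ)) μ μ := fun n => by
    have := h.iterate n
    rwa [show (shiftMap A)^[n] = shiftIter (n : ℤ) from funext (shiftMap_iterate n)] at this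
  obtain ⟨n, rfl | rfl⟩ := j.eq_nat_or_neg
  · exact hn n
  · refine ⟨measurable_shiftIter _, ?_⟩
    conv_lhs => rw [← (hn n).map_eq]
    rw [Measure.map_map (measurable_shiftIter _) (measurable_shiftIter _)]
    have : (shiftIter (-(n : ℤ)) : (ℤ → A) → _) ∘ shiftIter (n : ℤ) = id := by
      funext x i; simp [shiftIter]
    rw [this, Measure.map_id]

/-- The entropy of the distribution of words of length `n`. -/
noncomputable def wordEnt [Fintype A] (μ : Measure (ℤ → A)) (n : ℕ) : ℝ :=
  partEnt μ (prefixWord n)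

variable [Fintype A] [MeasurableSingletonClass A]

theorem fiberMeas_prefixWord (n : ℕ) : FiberMeas (prefixWord n : (ℤ → A) → _) :=
  (measurable_pi_lambda _ fun _ => measurable_pi_apply _ :
    Measurable (prefixWord n : (ℤ → A) → _)).fiberMeas

theorem fiberMeas_window' (a b : ℤ) : FiberMeas (window a b : (ℤ → A) → _) :=
  (measurable_pi_lambda _ fun _ => measurable_pi_apply _ :
    Measurable (window a b : (ℤ → A) → _)).fiberMeas

variable (μ : Measure (ℤ → A)) [IsProbabilityMeasure μ]

theorem partEnt_window (h : MeasurePreserving (shiftMap A) μ μ) {a b : ℤ} {n : ℕ}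
    (hab : b = a + n) : partEnt μ (window a b) = wordEnt μ n := by
  subst hab
  rw [wordEnt, ← partEnt_comp μ (fiberMeas_prefixWord n) (measurePreserving_shiftIter h a)]
  refine partEnt_congr μ ((fiberMeas_prefixWord n).comp_measurable (measurable_shiftIter a)) ?_ ?_
  · intro x y hxy
    refine window_eq_iff.2 fun i h1 h2 => ?_
    obtain ⟨m, rfl⟩ : ∃ m : ℕ, i = m + a := ⟨(i - a).toNat, by omega⟩
    exact congrFun hxy (⟨m, by omega⟩ : Fin n)
  · intro x y hxy
    refine funext fun i => ?_
    have := i.2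
    exact window_eq_iff.1 hxy _ (by omega) (by omega)

theorem wordEnt_subadditive (h : MeasurePreserving (shiftMap A) μ μ) :
    Subadditive (wordEnt μ) := by
  intro m n
  rw [← partEnt_window μ h (a := 0) (b := m) (n := m) (by simp),
    ← partEnt_window μ h (a := m) (b := m + n) (n := n) (by simp),
    ← partEnt_window μ h (a := 0) (b := m + n) (n := m + n) (by simp)]
  refine (partEnt_le_of_determines μ ((fiberMeas_window' _ _).prodMk (fiberMeas_window' _ _))
    fun x y hxy => ?_).trans (partEnt_prodMk_le μ (fiberMeas_window' _ _) (fiberMeas_window' _ _))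
  simp only [Prod.mk.injEq, window_eq_iff] at hxy ⊢
  intro i h1 h2
  rcases lt_or_ge i m with h3 | h3
  · exact hxy.1 i h1 h3
  · exact hxy.2 i h3 h2

theorem wordEnt_nonneg (n : ℕ) : 0 ≤ wordEnt μ n := partEnt_nonneg μ _

theorem bddBelow_wordEnt_div : BddBelow (range fun n : ℕ => wordEnt μ n / n) :=
  ⟨0, by rintro _ ⟨n, rfl⟩; exact div_nonneg (wordEnt_nonneg μ n) (by positivity)⟩

theorem wordEnt_le (n : ℕ) : wordEnt μ n ≤ n * Real.log (Fintype.card A) := by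
  obtain ⟨x₀⟩ : Nonempty (ℤ → A) := nonempty_of_isProbabilityMeasure μ
  have : Nonempty A := ⟨x₀ 0⟩
  refine (partEnt_le_log_card μ (fiberMeas_prefixWord n)).trans ?_
  simp

end Words

section ShiftEntropy

variable {A : Type*} [Fintype A] [TopologicalSpace A] [DiscreteTopology A] [MeasurableSpace A]
  [BorelSpace A] (μ : Measure (ℤ → A)) [IsProbabilityMeasure μ]

theorem bddAbove_entropyPart_shiftMap (h : MeasurePreserving (shiftMap A) μ μ) :
    BddAbove (range fun p : {q : Σ k : ℕ, (ℤ → A) → Fin k // Measurable q.2} =>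
      entropyPart μ (shiftMap A) p.1.2) := by
  refine ⟨2 * Real.log (Fintype.card A), ?_⟩
  rintro _ ⟨⟨⟨k, β⟩, hβ⟩, rfl⟩
  refine entropyPart_le_of_window μ h (fun p ε hε => ⟨2 * p, ?_⟩) hβ
  have hl : 0 ≤ Real.log (Fintype.card A) := Real.log_natCast_nonneg _
  have h1 : partEnt μ (fun x (i : Fin (2 * p + 1)) => window (-p : ℤ) p ((shiftMap A)^[i] x)) ≤
      partEnt μ (window (-p : ℤ) (-p + (4 * p : ℕ)) : (ℤ → A) → _) := by
    refine partEnt_le_of_determines μ (fiberMeas_window _ _) fun x y hxy => ?_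
    funext i
    have := i.2
    rw [window_eq_iff] at hxy ⊢
    intro j h1 h2
    rw [shiftMap_iterate, shiftMap_iterate]
    exact hxy _ (by omega) (by push_cast; omega)
  rw [partEnt_window μ h rfl] at h1
  have h2 := wordEnt_le μ (4 * p)
  push_cast at h2 ⊢
  nlinarith [mul_nonneg (Nat.cast_nonneg (α := ℝ) p) hε.le]

theorem lim_wordEnt_le_metricEntropy (h : MeasurePreserving (shiftMap A) μ μ) :
    (wordEnt_subadditive μ h).lim ≤ metricEntropy μ (shiftMap A) := by
  classical
  let e := Fintype.equivFin A
  have hm : Measurable (fun x : ℤ → A => e (x 0)) :=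
    (measurable_of_countable e).comp (measurable_pi_apply 0)
  refine le_trans ?_ (le_ciSup (bddAbove_entropyPart_shiftMap μ h)
    ⟨⟨Fintype.card A, fun x => e (x 0)⟩, hm⟩)
  refine le_ciInf fun n => ?_
  have h1 := (wordEnt_subadditive μ h).lim_le_div (bddBelow_wordEnt_div μ) n.succ_ne_zero
  refine h1.trans ?_
  push_cast
  refine div_le_div_of_nonneg_right ?_ (by positivity)
  refine partEnt_le_of_determines μ (FiberMeas.pi fun i => ?_) fun x y hxy => ?_
  · exact (hm.comp (h.iterate i).measurable).fiberMeas
  · funext i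
    have := e.injective (congrFun hxy i)
    rw [shiftMap_iterate, shiftMap_iterate] at this
    simpa [shiftIter, prefixWord] using this

end ShiftEntropy

section MeanErgodic

theorem Ergodic.tendsto_integral_abs_sum_sub_div {Ω : Type*} [MeasurableSpace Ω] {μ : Measure Ω}
    [IsProbabilityMeasure μ] {f : Ω → Ω} (hf : Ergodic f μ) {g : Ω → ℝ} (hg : Measurable g)
    {C : ℝ} (hC : ∀ x, |g x| ≤ C) :
    Tendsto (fun n : ℕ => (∫ x, |∑ i ∈ Finset.range n, (g (f^[i] x) - ∫ y, g y ∂μ)| ∂μ) / n)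
      atTop (𝓝 0) := by
  have hmp := hf.toMeasurePreserving
  have hgi : Integrable g μ := Integrable.of_bound hg.aestronglyMeasurable C
    (Eventually.of_forall hC)
  set c₀ := ∫ y, g y ∂μ with hc₀
  set g₀ : Ω → ℝ := fun x => g x - c₀ with hg₀
  have hg₀m : MemLp g₀ 2 μ := by
    refine MemLp.of_bound (hg.sub_const _).aestronglyMeasurable (C + |c₀|)
      (Eventually.of_forall fun x => ?_)
    exact (norm_sub_le _ _).trans (add_le_add (hC x) le_rfl)
  have hg₀int : ∫ x, g₀ x ∂μ = 0 := by
    rw [hg₀, integral_sub hgi (integrable_const _)]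
    simp [hc₀]
  set U : Lp ℝ 2 μ →L[ℝ] Lp ℝ 2 μ :=
    (Lp.compMeasurePreservingₗᵢ ℝ f hmp).toContinuousLinearMap with hU
  set v : Lp ℝ 2 μ := hg₀m.toLp g₀ with hv
  have hUn : ∀ n : ℕ, (U^[n] v : Ω → ℝ) =ᵐ[μ] fun x => g₀ (f^[n] x) := by
    intro n
    have h1 : (U : Lp ℝ 2 μ → Lp ℝ 2 μ) = Lp.compMeasurePreserving f hmp := rfl
    rw [h1, Lp.compMeasurePreserving_iterate]
    refine (Lp.coeFn_compMeasurePreserving _ (hmp.iterate n)).trans ?_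
    exact (hmp.iterate n).quasiMeasurePreserving.ae_eq_comp hg₀m.coeFn_toLp
  have hlim := U.tendsto_birkhoffAverage_orthogonalProjection
    (LinearIsometry.norm_toContinuousLinearMap_le _) v
  set w : Lp ℝ 2 μ := ((U.eqLocus (1 : Lp ℝ 2 μ →L[ℝ] Lp ℝ 2 μ)).orthogonalProjectionOnto v :
    Lp ℝ 2 μ) with hw
  have hwfix : U w = w :=
    ((U.eqLocus (1 : Lp ℝ 2 μ →L[ℝ] Lp ℝ 2 μ)).orthogonalProjectionOnto v).2
  have havg : ∀ n : ℕ, ((birkhoffAverage ℝ U id n v : Lp ℝ 2 μ) : Ω → ℝ) =ᵐ[μ]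
      fun x => (n : ℝ)⁻¹ * ∑ i ∈ Finset.range n, g₀ (f^[i] x) := by
    intro n
    have h1 : birkhoffAverage ℝ U id n v = (n : ℝ)⁻¹ • ∑ i ∈ Finset.range n, U^[i] v := rfl
    rw [h1]
    have h2 := Lp.coeFn_finsetSum (p := 2) (μ := μ) (Finset.range n) (fun i => U^[i] v)
    filter_upwards [Lp.coeFn_smul (n : ℝ)⁻¹ (∑ i ∈ Finset.range n, U^[i] v), h2,
      ae_all_iff.2 hUn] with x h3 h4 h5
    rw [h3, Pi.smul_apply, h4, smul_eq_mul]
    simp [Finset.sum_apply, h5]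
  have hwconst : ∃ c, (w : Ω → ℝ) =ᵐ[μ] Function.const Ω c := by
    refine hf.ae_eq_const_of_ae_eq_comp_ae (Lp.aestronglyMeasurable w) ?_
    have h1 := Lp.coeFn_compMeasurePreserving w hmp
    have h2 : Lp.compMeasurePreserving f hmp w = w := hwfix
    rw [h2] at h1
    exact h1.symm
  have hinner : ∀ n : ℕ, inner ℝ (indicatorConstLp 2 MeasurableSet.univ
      (measure_ne_top μ _) (1 : ℝ)) (birkhoffAverage ℝ U id n v) = 0 := by
    intro n
    rw [L2.inner_indicatorConstLp_one, setIntegral_univ, integral_congr_ae (havg n),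
      integral_const_mul, integral_finsetSum]
    · have : ∀ i, ∫ x, g₀ (f^[i] x) ∂μ = 0 := fun i => by
        have h1 := integral_map (μ := μ) (f := g₀) (hmp.iterate i).measurable.aemeasurable
          (hg.sub_const _).aestronglyMeasurable
        rw [← h1, (hmp.iterate i).map_eq, hg₀int]
      simp [this]
    · intro i _
      exact (hmp.iterate i).integrable_comp_of_integrable (hgi.sub (integrable_const _))
  have hw0 : w = 0 := by
    obtain ⟨c, hc⟩ := hwconst
    have h1 : inner ℝ (indicatorConstLp 2 MeasurableSet.univ
        (measure_ne_top μ _) (1 : ℝ)) w = 0 := by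
      refine tendsto_nhds_unique (tendsto_const_nhds.inner hlim) ?_
      exact tendsto_const_nhds.congr fun n => (hinner n).symm
    rw [L2.inner_indicatorConstLp_one, setIntegral_univ, integral_congr_ae hc] at h1
    have hc0 : c = 0 := by simpa using h1
    rw [Lp.eq_zero_iff_ae_eq_zero]
    filter_upwards [hc] with x hx
    simp [hx, hc0]
  rw [hw0] at hlim
  have hnorm := hlim.norm
  rw [norm_zero] at hnorm
  refine squeeze_zero (fun n => by positivity) (fun n => ?_) hnorm
  set h : Ω → ℝ := fun x => (n : ℝ)⁻¹ * ∑ i ∈ Finset.range n, g₀ (f^[i] x) with hh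
  have e1 : (∫ x, |∑ i ∈ Finset.range n, (g (f^[i] x) - c₀)| ∂μ) / n = ∫ x, ‖h x‖ ∂μ := by
    rw [div_eq_inv_mul, ← integral_const_mul]
    refine integral_congr_ae (Eventually.of_forall fun x => ?_)
    simp [hh, hg₀]
  have hhm : AEStronglyMeasurable h μ :=
    (Lp.aestronglyMeasurable (birkhoffAverage ℝ U id n v)).congr (havg n)
  rw [e1, integral_norm_eq_lintegral_enorm hhm, ← eLpNorm_one_eq_lintegral_enorm, Lp.norm_def,
    eLpNorm_congr_ae (havg n)]
  refine ENNReal.toReal_mono ?_ (eLpNorm_le_eLpNorm_of_exponent_le (by norm_num) hhm)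
  rw [← eLpNorm_congr_ae (havg n)]
  exact Lp.eLpNorm_ne_top _

end MeanErgodic

section OneSided

/-- `F x i` depends only on the coordinates of `x` at distance at most `r` from `i`. -/
def IsLocal {A : Type*} (F : (ℤ → A) → (ℤ → A)) (r : ℕ) : Prop :=
  ∀ (x y : ℤ → A) (i : ℤ), (∀ j, i - r ≤ j → j ≤ i + r → x j = y j) → F x i = F y i

theorem HasLocalRule.isLocal {A : Type*} {F : (ℤ → A) → (ℤ → A)} {r : ℕ}
    (h : HasLocalRule F r) : IsLocal F r := by
  obtain ⟨f, hf⟩ := h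
  intro x y i hxy
  rw [hf, hf]
  congr 1
  funext j
  have := j.2
  exact hxy _ (by omega) (by omega)

theorem IsLocal.iterate {A : Type*} {F : (ℤ → A) → (ℤ → A)} {r : ℕ} (h : IsLocal F r) (n : ℕ) :
    IsLocal F^[n] (r * n) := by
  induction n with
  | zero =>
    intro x y i hxy
    exact hxy i (by simp) (by simp)
  | succ n ih =>
    intro x y i hxy
    rw [Function.iterate_succ_apply', Function.iterate_succ_apply']
    refine h _ _ _ fun j h1 h2 => ih _ _ _ fun l h3 h4 => hxy l ?_ ?_
    · push_cast at h3 ⊢; linarith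
    · push_cast at h4 ⊢; linarith

variable {A : Type*} {X : Set (ℤ → A)} {F : (ℤ → A) → (ℤ → A)} {r : ℕ}

theorem subset_Wplus_iff (hFX : MapsTo F X X) (n s : ℕ) (x : ℤ → A) :
    (∀ i : ℕ, 1 ≤ i → i ≤ n → F^[i] '' Wplus X (-(s : ℤ)) x ⊆ Wplus X 0 (F^[i] x)) ↔
      ∀ i ≤ n, ∀ j : ℤ, 0 ≤ j → ∀ y ∈ X, (∀ l : ℤ, -(s : ℤ) ≤ l → y l = x l) →
        F^[i] y j = F^[i] x j := by
  constructor
  · intro h i hi j hj y hy hyx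
    rcases Nat.eq_zero_or_pos i with rfl | hi0
    · exact hyx j (by omega)
    · exact (h i hi0 hi ⟨y, ⟨hy, hyx⟩, rfl⟩).2 j hj
  · rintro h i - hi _ ⟨y, ⟨hy, hyx⟩, rfl⟩
    exact ⟨hFX.iterate i hy, fun j hj => h i hi j hj y hy hyx⟩

theorem mem_Iplus_set (hFX : MapsTo F X X) (hF : IsLocal F r) (n : ℕ) (x : ℤ → A) :
    ∀ i : ℕ, 1 ≤ i → i ≤ n →
      F^[i] '' Wplus X (-((r * n : ℕ) : ℤ)) x ⊆ Wplus X 0 (F^[i] x) := by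
  rw [subset_Wplus_iff hFX]
  intro i hi j hj y _ hyx
  refine hF.iterate i _ _ _ fun l h1 h2 => hyx l ?_
  have : r * i ≤ r * n := Nat.mul_le_mul_left r hi
  omega

theorem Iplus_le (hFX : MapsTo F X X) (hF : IsLocal F r) (n : ℕ) (x : ℤ → A) :
    Iplus X F n x ≤ r * n :=
  Nat.sInf_le (mem_Iplus_set hFX hF n x)

theorem Iplus_le_iff (hFX : MapsTo F X X) (hF : IsLocal F r) (n s : ℕ) (x : ℤ → A) :
    Iplus X F n x ≤ s ↔
      ∀ i ≤ n, ∀ j : ℤ, 0 ≤ j → ∀ y ∈ X, (∀ l : ℤ, -(s : ℤ) ≤ l → y l = x l) →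
        F^[i] y j = F^[i] x j := by
  rw [← subset_Wplus_iff hFX]
  refine ⟨fun h => ?_, fun h => Nat.sInf_le h⟩
  have hmem : ∀ i : ℕ, 1 ≤ i → i ≤ n →
      F^[i] '' Wplus X (-(Iplus X F n x : ℤ)) x ⊆ Wplus X 0 (F^[i] x) :=
    Nat.sInf_mem (s := {s : ℕ | ∀ i : ℕ, 1 ≤ i → i ≤ n →
      F^[i] '' Wplus X (-(s : ℤ)) x ⊆ Wplus X 0 (F^[i] x)}) ⟨r * n, mem_Iplus_set hFX hF n x⟩
  rw [subset_Wplus_iff hFX] at hmem ⊢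
  exact fun i hi j hj y hy hyx => hmem i hi j hj y hy fun l hl => hyx l (by omega)

variable [Fintype A] [TopologicalSpace A] [DiscreteTopology A]

/-- The points `x` such that agreement with `x` on the coordinates in `P` forces, inside `X`, the
same value of `φ` form an open set. -/
theorem isOpen_ofPred_forall_agree {T : Type*} [TopologicalSpace T] [DiscreteTopology T]
    (hX : IsClosed X) {φ : (ℤ → A) → T} (hφ : Continuous φ) (P : ℤ → Prop) :
    IsOpen {x : ℤ → A | ∀ y ∈ X, (∀ l, P l → y l = x l) → φ y = φ x} := by
  have hK : IsClosed {p : (ℤ → A) × (ℤ → A) |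
      p.2 ∈ X ∧ (∀ l, P l → p.2 l = p.1 l) ∧ φ p.2 ≠ φ p.1} := by
    refine (hX.preimage continuous_snd).inter (IsClosed.inter ?_ ?_)
    · change IsClosed {p : (ℤ → A) × (ℤ → A) | ∀ l, P l → p.2 l = p.1 l}
      simp only [ofPred_forall]
      exact isClosed_iInter fun l => isClosed_iInter fun _ => isClosed_eq
        ((continuous_apply l).comp continuous_snd) ((continuous_apply l).comp continuous_fst)
    · have : Continuous fun p : (ℤ → A) × (ℤ → A) => (φ p.2, φ p.1) :=
        (hφ.comp continuous_snd).prodMk (hφ.comp continuous_fst)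
      exact (isClosed_discrete {q : T × T | q.1 ≠ q.2}).preimage this
  have := isClosedMap_fst_of_compactSpace _ hK
  rw [← isOpen_compl_iff] at this
  convert this using 1
  ext x
  simp only [mem_ofPred_eq, mem_compl_iff, mem_image, Prod.exists, not_exists]
  constructor
  · rintro h a b ⟨⟨h1, h2, h3⟩, rfl⟩
    exact h3 (h b h1 h2)
  · intro h y hy hyx
    by_contra hne
    exact h x y ⟨⟨hy, hyx, hne⟩, rfl⟩

/-- If agreement on `[-s, ∞)` determines `φ` then agreement on some finite window does. -/
theorem exists_window_determines {T : Type*} [TopologicalSpace T] [DiscreteTopology T]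
    (hX : IsClosed X) {φ : (ℤ → A) → T} (hφ : Continuous φ) (s : ℤ) (x : ℤ → A)
    (h : ∀ y ∈ X, (∀ l, s ≤ l → y l = x l) → φ y = φ x) :
    ∃ M : ℕ, ∀ y ∈ X, (∀ l, s ≤ l → l < M → y l = x l) → φ y = φ x := by
  by_contra hcon
  push Not at hcon
  set K : ℕ → Set (ℤ → A) := fun M => {y | y ∈ X ∧ (∀ l, s ≤ l → l < M → y l = x l) ∧ φ y ≠ φ x}
    with hK
  have hcl : ∀ M, IsClosed (K M) := fun M => by
    refine hX.inter (IsClosed.inter ?_ ?_)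
    · change IsClosed {y : ℤ → A | ∀ l, s ≤ l → l < M → y l = x l}
      simp only [ofPred_forall]
      exact isClosed_iInter fun l => isClosed_iInter fun _ => isClosed_iInter fun _ => isClosed_eq
        (continuous_apply l) continuous_const
    · exact (isClosed_discrete {q : T | q ≠ φ x}).preimage hφ
  obtain ⟨y, hy⟩ := IsCompact.nonempty_iInter_of_sequence_nonempty_isCompact_isClosed K
    (fun M y hy => ⟨hy.1, fun l h1 h2 => hy.2.1 l h1 (by push_cast; omega), hy.2.2⟩)
    (fun M => by obtain ⟨y, h1, h2, h3⟩ := hcon M; exact ⟨y, h1, h2, h3⟩)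
    (hcl 0).isCompact hcl
  rw [mem_iInter] at hy
  exact (hy 0).2.2 (h y (hy 0).1 fun l hl => (hy (l.toNat + 1)).2.1 l hl (by push_cast; omega))

variable [MeasurableSpace A] [BorelSpace A]

theorem measurable_Iplus (hX : IsClosed X) (hFX : MapsTo F X X) (hFc : Continuous F)
    (hF : IsLocal F r) (n : ℕ) : Measurable (Iplus X F n) := by
  refine measurable_of_Iic fun s => ?_
  have : Iplus X F n ⁻¹' Iic s = ⋂ i, ⋂ (_ : i ≤ n), ⋂ j : ℤ, ⋂ (_ : 0 ≤ j),
      {x : ℤ → A | ∀ y ∈ X, (∀ l, -(s : ℤ) ≤ l → y l = x l) → F^[i] y j = F^[i] x j} := by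
    ext x
    simp only [mem_preimage, mem_Iic, Iplus_le_iff hFX hF, mem_iInter, mem_ofPred_eq]
  rw [this]
  refine MeasurableSet.iInter fun i => MeasurableSet.iInter fun _ => MeasurableSet.iInter fun j =>
    MeasurableSet.iInter fun _ => ?_
  exact (isOpen_ofPred_forall_agree hX ((continuous_apply j).comp (hFc.iterate i)) _).measurableSet

/-- The first `n + 1` iterates of `x` seen through the window `[0, p)`. -/
def column (F : (ℤ → A) → (ℤ → A)) (p n : ℕ) (x : ℤ → A) (i : Fin (n + 1)) :
    Finset.Ico (0 : ℤ) p → A :=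
  window 0 p (F^[i] x)

theorem continuous_column (hFc : Continuous F) (p n : ℕ) : Continuous (column F p n) :=
  continuous_pi fun i => (continuous_window 0 p).comp (hFc.iterate i)

theorem fiberMeas_column (hFc : Continuous F) (p n : ℕ) : FiberMeas (column F p n) :=
  fun s => ((isOpen_discrete {s}).preimage (continuous_column hFc p n)).measurableSet

/-- The points of `X` whose column is determined, inside `X`, by the window `[-I, M)`. -/
def goodSet (X : Set (ℤ → A)) (F : (ℤ → A) → (ℤ → A)) (p n M : ℕ) : Set (ℤ → A) :=
  {x | x ∈ X ∧ ∀ y ∈ X, (∀ l : ℤ, -(Iplus X F n x : ℤ) ≤ l → l < M → y l = x l) →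
    column F p n y = column F p n x}

theorem measurableSet_goodSet (hX : IsClosed X) (hFX : MapsTo F X X) (hFc : Continuous F)
    (hF : IsLocal F r) (p n M : ℕ) : MeasurableSet (goodSet X F p n M) := by
  have : goodSet X F p n M = X ∩ ⋃ s : ℕ, (Iplus X F n ⁻¹' {s} ∩
      {x : ℤ → A | ∀ y ∈ X, (∀ l : ℤ, (-(s : ℤ) ≤ l ∧ l < M) → y l = x l) →
        column F p n y = column F p n x}) := by
    ext x
    simp [goodSet]
  rw [this]
  refine hX.measurableSet.inter (MeasurableSet.iUnion fun s => ?_)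
  exact (measurable_Iplus hX hFX hFc hF n (measurableSet_singleton s)).inter
    (isOpen_ofPred_forall_agree hX (continuous_column hFc p n) _).measurableSet

theorem tendsto_measure_goodSet_compl (hX : IsClosed X) (hFX : MapsTo F X X) (hFc : Continuous F)
    (hF : IsLocal F r) (p n : ℕ) {μ : Measure (ℤ → A)} [IsProbabilityMeasure μ]
    (hμX : ∀ᵐ x ∂μ, x ∈ X) :
    Tendsto (fun M => μ.real (goodSet X F p n M)ᶜ) atTop (𝓝 0) := by
  have hanti : Antitone fun M => (goodSet X F p n M)ᶜ := by
    intro M M' hM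
    refine compl_subset_compl.2 fun x hx => ⟨hx.1, fun y hy hyx => hx.2 y hy fun l h1 h2 => ?_⟩
    exact hyx l h1 (by omega)
  have h0 : μ (⋂ M, (goodSet X F p n M)ᶜ) = 0 := by
    rw [← compl_iUnion]
    refine measure_mono_null (compl_subset_compl.2 fun x (hx : x ∈ X) => ?_) (ae_iff.1 hμX)
    have hI := (Iplus_le_iff hFX hF n _ x).1 le_rfl
    obtain ⟨M, hM⟩ := exists_window_determines hX (continuous_column hFc p n)
      (-(Iplus X F n x : ℤ)) x fun y hy hyx => by
        funext i
        exact window_eq_iff.2 fun j h1 _ =>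
          hI i (Nat.lt_succ_iff.1 i.2) j h1 y hy hyx
    exact mem_iUnion.2 ⟨M, hx, hM⟩
  have := tendsto_measure_iInter_atTop (μ := μ)
    (fun M => (measurableSet_goodSet hX hFX hFc hF p n M).compl.nullMeasurableSet) hanti
    ⟨0, measure_ne_top _ _⟩
  rw [h0] at this
  exact (ENNReal.tendsto_toReal ENNReal.zero_ne_top).comp this

end OneSided

section Crossing

open Classical in
theorem fiberMeas_option {Ω S : Type*} [MeasurableSpace Ω] [Finite S] {J : ℕ}
    {β : Fin J → Ω → S} (hβ : ∀ j, FiberMeas (β j)) {B : Fin J → Set Ω}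
    (hB : ∀ j, MeasurableSet (B j)) :
    FiberMeas fun x j => if x ∈ B j then some (β j x) else none := by
  refine FiberMeas.pi fun j => ?_
  have h1 : FiberMeas fun x => (β j x, decide (x ∈ B j)) := (hβ j).prodMk fun b => by
    cases b
    · convert (hB j).compl using 1; ext x; simp
    · convert hB j using 1; ext x; simp
  refine h1.of_determines fun x y h => ?_
  simp only [Prod.mk.injEq, decide_eq_decide] at h
  simp only [h.1, h.2]

open Classical in
/-- Coding with product weights: each coordinate either carries a symbol `β j x` or nothing. -/
theorem partEnt_option_le {Ω S : Type*} [MeasurableSpace Ω] [Fintype S] (μ : Measure Ω)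
    [IsProbabilityMeasure μ] {J : ℕ} {β : Fin J → Ω → S} (hβ : ∀ j, FiberMeas (β j))
    {B : Fin J → Set Ω} (hB : ∀ j, MeasurableSet (B j)) :
    partEnt μ (fun x j => if x ∈ B j then some (β j x) else none) ≤ J * Real.log 2 +
      ∫ x, ∑ j, (B j).indicator (fun x => -Real.log (μ.real (β j ⁻¹' {β j x}))) x ∂μ := by
  set V : Ω → Fin J → Option S := fun x j => if x ∈ B j then some (β j x) else none with hV
  have hVm : FiberMeas V := fiberMeas_option hβ hB
  set q : Fin J → Option S → ℝ := fun j o => o.elim (1 / 2) fun s => μ.real (β j ⁻¹' {s}) / 2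
    with hq
  have hq0 : ∀ j o, 0 ≤ q j o := by
    rintro j (_ | s)
    · simp [hq]
    · simp only [hq, Option.elim_some]; positivity
  have hq1 : ∀ j, ∑ o, q j o = 1 := by
    intro j
    rw [Fintype.sum_option]
    simp only [hq, Option.elim_none, Option.elim_some]
    rw [← Finset.sum_div, (hβ j).sum_real μ]
    norm_num
  have hae : ∀ᵐ x ∂μ, ∀ j, 0 < μ.real (β j ⁻¹' {β j x}) :=
    ae_all_iff.2 fun j => FiberMeas.ae_real_pos μ
  have hpos : ∀ᵐ x ∂μ, ∀ j, 0 < q j (V x j) := by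
    filter_upwards [hae] with x hx j
    simp only [hq, hV]
    split_ifs
    · simpa using hx j
    · simp
  refine (partEnt_le_integral_neg_log μ hVm (fun v => ∏ j, q j (v j))
    (fun v => Finset.prod_nonneg fun j _ => hq0 j _) ?_ ?_).trans ?_
  · have := Finset.prod_univ_sum (fun _ : Fin J => (Finset.univ : Finset (Option S))) q
    rw [Fintype.piFinset_univ] at this
    rw [← this]
    simp [hq1]
  · filter_upwards [hpos] with x hx
    exact Finset.prod_pos fun j _ => hx j
  · have hint : Integrable (fun x => ∑ j, (B j).indicator
        (fun x => -Real.log (μ.real (β j ⁻¹' {β j x}))) x) μ :=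
      integrable_finsetSum _ fun j _ =>
        ((hβ j).integrable_comp μ (fun s => -Real.log (μ.real (β j ⁻¹' {s})))).indicator (hB j)
    have e : ∫ x, (J * Real.log 2 + ∑ j, (B j).indicator
        (fun x => -Real.log (μ.real (β j ⁻¹' {β j x}))) x) ∂μ = J * Real.log 2 +
        ∫ x, ∑ j, (B j).indicator (fun x => -Real.log (μ.real (β j ⁻¹' {β j x}))) x ∂μ := by
      rw [integral_add (integrable_const _) hint]
      simp
    rw [← e]
    refine le_of_eq (integral_congr_ae ?_)
    filter_upwards [hae, hpos] with x hx hx'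
    rw [Real.log_prod fun j _ => (hx' j).ne', ← Finset.sum_neg_distrib]
    have : (J : ℝ) * Real.log 2 = ∑ _j : Fin J, Real.log 2 := by simp
    rw [this, ← Finset.sum_add_distrib]
    refine Finset.sum_congr rfl fun j _ => ?_
    by_cases hxj : x ∈ B j
    · simp only [hV, hq, hxj, if_true, Option.elim_some, indicator_of_mem]
      rw [Real.log_div (hx j).ne' two_ne_zero]
      ring
    · simp [hV, hq, hxj]

/-- The information function of the length-`k` word at the origin. -/
noncomputable def wordInfo {A : Type*} [MeasurableSpace A] (μ : Measure (ℤ → A)) (k : ℕ)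
    (x : ℤ → A) : ℝ :=
  -Real.log (μ.real (prefixWord k ⁻¹' {prefixWord k x}))

section

variable {A : Type*} [Fintype A] [MeasurableSpace A] [MeasurableSingletonClass A]
  (μ : Measure (ℤ → A)) [IsProbabilityMeasure μ]

theorem measurable_wordInfo (k : ℕ) : Measurable (wordInfo μ k) :=
  (fiberMeas_prefixWord k).measurable_comp fun s => -Real.log (μ.real (prefixWord k ⁻¹' {s}))

theorem wordInfo_nonneg (k : ℕ) (x : ℤ → A) : 0 ≤ wordInfo μ k x :=
  neg_nonneg.2 (Real.log_nonpos measureReal_nonneg measureReal_le_one)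

theorem exists_wordInfo_le (k : ℕ) : ∃ C, ∀ x, |wordInfo μ k x| ≤ C := by
  refine ⟨∑ s : Fin k → A, |Real.log (μ.real (prefixWord k ⁻¹' {s}))|, fun x => ?_⟩
  rw [wordInfo, abs_neg]
  exact Finset.single_le_sum (f := fun s => |Real.log (μ.real (prefixWord k ⁻¹' {s}))|)
    (fun _ _ => abs_nonneg _) (Finset.mem_univ (prefixWord k x))

theorem integral_wordInfo (k : ℕ) : ∫ x, wordInfo μ k x ∂μ = wordEnt μ k :=
  (partEnt_eq_integral μ (fiberMeas_prefixWord k)).symm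

theorem integrable_wordInfo (k : ℕ) : Integrable (wordInfo μ k) μ :=
  (fiberMeas_prefixWord k).integrable_comp μ fun s => -Real.log (μ.real (prefixWord k ⁻¹' {s}))

variable {μ} in
theorem wordInfo_shiftIter (h : MeasurePreserving (shiftMap A) μ μ) (k : ℕ) (j : ℤ) (x : ℤ → A) :
    wordInfo μ k (shiftIter j x) = -Real.log (μ.real
      ((fun y => prefixWord k (shiftIter j y)) ⁻¹' {prefixWord k (shiftIter j x)})) := by
  rw [wordInfo, ← (measurePreserving_shiftIter h j).measureReal_preimage
    (fiberMeas_prefixWord k _).nullMeasurableSet]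
  rfl

/-- The deviation of the information sum over blocks of length `l`. -/
noncomputable def infoDev (k l : ℕ) : ℝ :=
  ∫ x, |∑ i ∈ Finset.range l, (wordInfo μ k (shiftIter i x) - wordEnt μ k)| ∂μ

theorem infoDev_nonneg (k l : ℕ) : 0 ≤ infoDev μ k l := integral_nonneg fun _ => abs_nonneg _

variable {μ} in
theorem tendsto_infoDev (h : Ergodic (shiftMap A) μ) (k : ℕ) :
    Tendsto (fun l : ℕ => infoDev μ k l / l) atTop (𝓝 0) := by
  obtain ⟨C, hC⟩ := exists_wordInfo_le μ k
  have := h.tendsto_integral_abs_sum_sub_div (measurable_wordInfo μ k) hC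
  simpa only [infoDev, shiftMap_iterate, integral_wordInfo] using this

variable {μ} in
theorem integrable_wordInfo_shiftIter (h : MeasurePreserving (shiftMap A) μ μ) (k : ℕ) (j : ℤ) :
    Integrable (fun x => wordInfo μ k (shiftIter j x)) μ :=
  (measurePreserving_shiftIter h j).integrable_comp_of_integrable (integrable_wordInfo μ k)

variable {μ} in
theorem integral_infoDev_shiftIter (h : MeasurePreserving (shiftMap A) μ μ) (k l : ℕ) (a : ℤ) :
    ∫ x, |∑ u ∈ Finset.range l, (wordInfo μ k (shiftIter (a - u) x) - wordEnt μ k)| ∂μ =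
      infoDev μ k l := by
  have hm : Measurable fun x : ℤ → A =>
      |∑ i ∈ Finset.range l, (wordInfo μ k (shiftIter i x) - wordEnt μ k)| :=
    (Finset.measurable_fun_sum _ fun i _ =>
      ((measurable_wordInfo μ k).comp (measurable_shiftIter _)).sub_const _).norm
  have hp := measurePreserving_shiftIter h (a - l + 1)
  have h1 := integral_map (μ := μ) hp.measurable.aemeasurable hm.aestronglyMeasurable
  rw [hp.map_eq] at h1
  rw [infoDev, h1]
  refine integral_congr_ae (Eventually.of_forall fun x => ?_)
  simp only
  rw [← Finset.sum_range_reflect]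
  congr 1
  refine Finset.sum_congr rfl fun i hi => ?_
  rw [Finset.mem_range] at hi
  rw [← shiftIter_add]
  congr 3
  have : ((l - 1 - i : ℕ) : ℤ) = l - 1 - i := by omega
  rw [this]; ring

end

theorem sum_range_mul_eq {M : Type*} [AddCommMonoid M] (f : ℕ → M) (J k : ℕ) :
    ∑ i ∈ Finset.range (J * k), f i =
      ∑ j ∈ Finset.range J, ∑ u ∈ Finset.range k, f (j * k + u) := by
  induction J with
  | zero => simp
  | succ J ih => rw [Nat.succ_mul, Finset.sum_range_add, ih, Finset.sum_range_succ]

theorem sum_ite_mul_lt_le (N l Q : ℕ) (hl : 1 ≤ l) :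
    ∑ b ∈ Finset.range Q, (if b * l < N then (l : ℝ) else 0) ≤ N + l := by
  rw [← Finset.sum_filter]
  have hsub : (Finset.range Q).filter (fun b => b * l < N) ⊆ Finset.range (N / l + 1) := by
    intro b hb
    rw [Finset.mem_filter] at hb
    rw [Finset.mem_range, Nat.lt_succ_iff, Nat.le_div_iff_mul_le hl]
    exact hb.2.le
  refine (Finset.sum_le_sum_of_subset_of_nonneg hsub fun _ _ _ => Nat.cast_nonneg l).trans ?_
  rw [Finset.sum_const, Finset.card_range, nsmul_eq_mul]
  have := Nat.div_mul_le_self N l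
  have h2 : ((N / l * l : ℕ) : ℝ) ≤ N := by exact_mod_cast this
  push_cast at h2 ⊢
  linarith

theorem sum_phase_le (W : ℕ → ℝ) (hW : ∀ i, 0 ≤ W i) {I J k m : ℕ} (hm : J * k ≤ m) :
    ∑ u ∈ Finset.range k, ∑ j : Fin J, (if j * k < I then W (j * k + u) else 0) ≤
      ∑ i ∈ Finset.range m, (if i < I + k then W i else 0) := by
  have h0 : ∀ i, 0 ≤ (if i < I + k then W i else 0) := fun i => by
    split_ifs
    · exact hW i
    · exact le_rfl
  refine le_trans ?_ (Finset.sum_le_sum_of_subset_of_nonneg (Finset.range_mono hm)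
    fun i _ _ => h0 i)
  rw [sum_range_mul_eq, Finset.sum_comm, Fin.sum_univ_eq_sum_range (fun j => ∑ u ∈ Finset.range k,
    (if j * k < I then W (j * k + u) else 0)) J]
  refine Finset.sum_le_sum fun j _ => Finset.sum_le_sum fun u hu => ?_
  rw [Finset.mem_range] at hu
  by_cases h : j * k < I
  · rw [if_pos h, if_pos (by omega)]
  · rw [if_neg h]
    exact h0 _

theorem integral_block_le {A : Type*} [Fintype A] [MeasurableSpace A] [MeasurableSingletonClass A]
    {μ : Measure (ℤ → A)} [IsProbabilityMeasure μ] (h : MeasurePreserving (shiftMap A) μ μ)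
    (k Q : ℕ) {l : ℕ} (hl : 1 ≤ l) (c : ℤ) {N : (ℤ → A) → ℕ} (hN : Measurable N)
    (hNi : Integrable (fun x => (N x : ℝ)) μ) :
    Integrable (fun x => ∑ i ∈ Finset.range (Q * l),
      (if i < N x then wordInfo μ k (shiftIter (c - i) x) else 0)) μ ∧
    ∫ x, ∑ i ∈ Finset.range (Q * l),
      (if i < N x then wordInfo μ k (shiftIter (c - i) x) else 0) ∂μ ≤
      wordEnt μ k * (∫ x, (N x : ℝ) ∂μ + l) + Q * infoDev μ k l := by
  have hint : Integrable (fun x => ∑ i ∈ Finset.range (Q * l),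
      (if i < N x then wordInfo μ k (shiftIter (c - i) x) else 0)) μ := by
    refine integrable_finsetSum _ fun i _ => ?_
    convert (integrable_wordInfo_shiftIter h k (c - i)).indicator
      (s := {x | i < N x}) (hN measurableSet_Ioi) using 2 with x
    simp [indicator_apply]
  refine ⟨hint, ?_⟩
  have hD : ∀ b : ℕ, Integrable (fun x => |∑ u ∈ Finset.range l,
      (wordInfo μ k (shiftIter (c - (b * l : ℕ) - u) x) - wordEnt μ k)|) μ := fun b =>
    (integrable_finsetSum _ fun u _ =>
      (integrable_wordInfo_shiftIter h k _).sub (integrable_const _)).abs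
  have hDs := integrable_finsetSum (Finset.range Q) fun b _ => hD b
  have hNl : Integrable (fun x => wordEnt μ k * ((N x : ℝ) + l)) μ :=
    (hNi.add (integrable_const _)).const_mul _
  have e : ∫ x, (wordEnt μ k * ((N x : ℝ) + l) + ∑ b ∈ Finset.range Q, |∑ u ∈ Finset.range l,
      (wordInfo μ k (shiftIter (c - (b * l : ℕ) - u) x) - wordEnt μ k)|) ∂μ =
      wordEnt μ k * (∫ x, (N x : ℝ) ∂μ + l) + Q * infoDev μ k l := by
    rw [integral_add hNl hDs, integral_const_mul, integral_add hNi (integrable_const _),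
      integral_finsetSum _ fun b _ => hD b]
    simp only [integral_infoDev_shiftIter h]
    simp
  rw [← e]
  refine integral_mono hint (hNl.add hDs) fun x => ?_
  simp only
  have h1 : ∀ b ∈ Finset.range Q, ∑ u ∈ Finset.range l, (if b * l + u < N x then
      wordInfo μ k (shiftIter (c - (b * l + u : ℕ)) x) else 0) ≤
      wordEnt μ k * (if b * l < N x then (l : ℝ) else 0) + |∑ u ∈ Finset.range l,
        (wordInfo μ k (shiftIter (c - (b * l : ℕ) - u) x) - wordEnt μ k)| := by
    intro b _
    by_cases hb : b * l < N x
    · rw [if_pos hb]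
      calc _ ≤ ∑ u ∈ Finset.range l, wordInfo μ k (shiftIter (c - (b * l : ℕ) - u) x) := by
            refine Finset.sum_le_sum fun u _ => ?_
            split_ifs
            · rw [Nat.cast_add, sub_sub]
            · exact wordInfo_nonneg μ k _
        _ = wordEnt μ k * l + ∑ u ∈ Finset.range l,
            (wordInfo μ k (shiftIter (c - (b * l : ℕ) - u) x) - wordEnt μ k) := by
            rw [Finset.sum_sub_distrib]; simp; ring
        _ ≤ _ := add_le_add le_rfl (le_abs_self _)
    · rw [if_neg hb, mul_zero, zero_add, Finset.sum_eq_zero]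
      · exact abs_nonneg _
      · intro u _
        rw [if_neg (by omega)]
  rw [sum_range_mul_eq]
  refine (Finset.sum_le_sum h1).trans ?_
  rw [Finset.sum_add_distrib, ← Finset.mul_sum]
  exact add_le_add (mul_le_mul_of_nonneg_left (sum_ite_mul_lt_le _ _ _ hl) (wordEnt_nonneg μ k))
    le_rfl

end Crossing

section RightEstimate

theorem condEnt_le_add_condEnt_triple {Ω S T R Q : Type*} [MeasurableSpace Ω] [Fintype S]
    [Fintype T] [Fintype R] [Fintype Q] (μ : Measure Ω) [IsProbabilityMeasure μ] {α : Ω → S}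
    {β : Ω → T} {γ : Ω → R} {δ : Ω → Q} (hα : FiberMeas α) (hβ : FiberMeas β) (hγ : FiberMeas γ)
    (hδ : FiberMeas δ) :
    condEnt μ α δ ≤ partEnt μ β + partEnt μ γ + condEnt μ α (fun x => (β x, γ x, δ x)) := by
  have h1 : partEnt μ (fun x => (α x, δ x)) ≤ partEnt μ (fun x => (α x, β x, γ x, δ x)) :=
    partEnt_le_of_determines μ (hα.prodMk (hβ.prodMk (hγ.prodMk hδ))) fun x y h => by simp_all
  have h2 := partEnt_prodMk_le μ hβ (hγ.prodMk hδ)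
  have h3 := partEnt_prodMk_le μ hγ hδ
  unfold condEnt
  linarith

variable {A : Type*} {X : Set (ℤ → A)} {F : (ℤ → A) → (ℤ → A)} {r : ℕ}

/-- The words of length `k` to the left of `-ϕ`, as far as the `j`-th one meets `[-I x, -ϕ)`. -/
noncomputable def revealed (I : (ℤ → A) → ℕ) (k J ϕ : ℕ) (x : ℤ → A) (j : Fin J) :
    Option (Fin k → A) :=
  if (j : ℕ) * k < I x then
    some (prefixWord k (shiftIter (-(k : ℤ) - ((j * k + ϕ : ℕ) : ℤ)) x)) else none

theorem eq_of_revealed_eq {I : (ℤ → A) → ℕ} {k J ϕ : ℕ} (hk : 1 ≤ k) {x y : ℤ → A}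
    (hI : I x ≤ J * k) (h : revealed I k J ϕ x = revealed I k J ϕ y) (l : ℤ) (h1 : -(I x : ℤ) ≤ l)
    (h2 : l < -ϕ) : x l = y l := by
  obtain ⟨m, hm⟩ : ∃ m : ℕ, (m : ℤ) = -ϕ - 1 - l := ⟨(-ϕ - 1 - l).toNat, by omega⟩
  have hd := Nat.div_add_mod' m k
  have hmod := Nat.mod_lt m (show 0 < k by omega)
  have hjI : m / k * k < I x := by omega
  have hjJ : m / k < J := by
    by_contra hcon
    push Not at hcon
    have := Nat.mul_le_mul_right k hcon
    omega
  have := congrFun h ⟨m / k, hjJ⟩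
  unfold revealed at this
  rw [if_pos hjI] at this
  split_ifs at this
  have h3 := congrFun (Option.some.inj this) ⟨k - 1 - m % k, by omega⟩
  simp only [prefixWord, shiftIter] at h3
  have e : ((k - 1 - m % k : ℕ) : ℤ) + (-(k : ℤ) - ((m / k * k + ϕ : ℕ) : ℤ)) = l := by omega
  rwa [e] at h3

variable [Fintype A] [TopologicalSpace A] [DiscreteTopology A] [MeasurableSpace A] [BorelSpace A]
  {μ : Measure (ℤ → A)} [IsProbabilityMeasure μ]

theorem mul_condEnt_column_le (hX : IsClosed X) (hFX : MapsTo F X X) (hFc : Continuous F)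
    (hF : IsLocal F r) (h : MeasurePreserving (shiftMap A) μ μ) (hμX : ∀ᵐ x ∂μ, x ∈ X)
    (p n : ℕ) {k l : ℕ} (hk : 1 ≤ k) (hl : 1 ≤ l) :
    ∃ M : ℕ, k * condEnt μ (column F p n) (window 0 M) ≤
      k * (1 + k * Real.log (Fintype.card A) + (r * n / k + 1 : ℕ) * Real.log 2) +
        (wordEnt μ k * (∫ x, (Iplus X F n x : ℝ) ∂μ + k + l) +
          (((r * n / k + 1) * k) / l + 1 : ℕ) * infoDev μ k l) := by
  set I := Iplus X F n with hI
  set J := r * n / k + 1 with hJ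
  have hIJ : ∀ x, I x ≤ J * k := fun x => by
    have h1 : I x ≤ r * n := Iplus_le hFX hF n x
    have h2 := Nat.lt_div_mul_add (a := r * n) (b := k) (by omega)
    have h3 : J * k = r * n / k * k + k := by rw [hJ]; ring
    omega
  have hIm : Measurable I := measurable_Iplus hX hFX hFc hF n
  have hIi : Integrable (fun x => (I x : ℝ)) μ := by
    refine Integrable.of_bound (measurable_from_nat.comp hIm).aestronglyMeasurable (r * n : ℕ)
      (Eventually.of_forall fun x => ?_)
    rw [Real.norm_natCast]
    exact_mod_cast Iplus_le hFX hF n x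
  obtain ⟨x₀⟩ : Nonempty (ℤ → A) := nonempty_of_isProbabilityMeasure μ
  have hne : Nonempty (Fin (n + 1) → Finset.Ico (0 : ℤ) p → A) := ⟨fun _ _ => x₀ 0⟩
  have hcard : (1 : ℝ) ≤ Fintype.card (Fin (n + 1) → Finset.Ico (0 : ℤ) p → A) := by
    exact_mod_cast Fintype.card_pos
  obtain ⟨η, δ, hη0, hη1, hδ, hm⟩ := exists_neg_log_one_sub_add_mul_log_lt hcard one_pos
  obtain ⟨M, hM⟩ := ((tendsto_order.1
    (tendsto_measure_goodSet_compl hX hFX hFc hF p n hμX)).2 δ hδ).exists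
  have hlog : 0 ≤ Real.log (Fintype.card A) := Real.log_natCast_nonneg _
  set ind : ℕ → Fin J → (ℤ → A) → ℝ := fun u j x =>
    if j * k < I x then wordInfo μ k (shiftIter (-(k : ℤ) - ((j * k + u : ℕ) : ℤ)) x) else 0
    with hind
  have hindi : ∀ u j, Integrable (ind u j) μ := fun u j => by
    have := (integrable_wordInfo_shiftIter h k (-(k : ℤ) - ((j * k + u : ℕ) : ℤ))).indicator
      (s := {x | j * k < I x}) (hIm measurableSet_Ioi)
    refine this.congr (Eventually.of_forall fun x => ?_)
    simp only [hind, indicator_apply, mem_ofPred_eq]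
  refine ⟨M, ?_⟩
  have hphase : ∀ u ∈ Finset.range k, condEnt μ (column F p n) (window 0 M) ≤
      (1 + k * Real.log (Fintype.card A) + J * Real.log 2) + ∫ x, ∑ j, ind u j x ∂μ := by
    intro u hu
    have hβm : ∀ j : Fin J, FiberMeas
        (fun x : ℤ → A => prefixWord k (shiftIter (-(k : ℤ) - ((j * k + u : ℕ) : ℤ)) x)) :=
      fun j => (fiberMeas_prefixWord k).comp_measurable (measurable_shiftIter _)
    have hrev : revealed I k J u = fun x (j : Fin J) =>
        @ite _ (x ∈ {x | (j : ℕ) * k < I x}) (Classical.propDecidable _)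
          (some (prefixWord k (shiftIter (-(k : ℤ) - ((j * k + u : ℕ) : ℤ)) x))) none := by
      funext x j
      by_cases hxj : (j : ℕ) * k < I x
      · rw [revealed, if_pos hxj, if_pos (by exact hxj)]
      · rw [revealed, if_neg hxj, if_neg (by exact hxj)]
    have hV := partEnt_option_le μ hβm (B := fun j => {x | (j : ℕ) * k < I x})
      fun j => hIm measurableSet_Ioi
    rw [← hrev] at hV
    have hVm : FiberMeas (revealed I k J u) := by
      rw [hrev]
      exact fiberMeas_option hβm fun j => hIm measurableSet_Ioi
    have hU : partEnt μ (window (-(u : ℤ)) 0) ≤ k * Real.log (Fintype.card A) := by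
      rw [partEnt_window μ h (n := u) (by simp)]
      refine (wordEnt_le μ u).trans (mul_le_mul_of_nonneg_right ?_ hlog)
      exact_mod_cast (Finset.mem_range.1 hu).le
    have hfano := condEnt_le_of_determines_on μ (fiberMeas_column hFc p n)
      (hVm.prodMk ((fiberMeas_window (-(u : ℤ)) 0).prodMk (fiberMeas_window 0 M)))
      (measurableSet_goodSet hX hFX hFc hF p n M) (fun x hx y hy hxy => ?_) hη0 hη1
    · have h1 := condEnt_le_add_condEnt_triple μ (fiberMeas_column hFc p n) hVm
        (fiberMeas_window (-(u : ℤ)) 0) (fiberMeas_window 0 M)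
      have h2 := hm _ hM
      have h3 : partEnt μ (revealed I k J u) ≤ J * Real.log 2 + ∫ x, ∑ j, ind u j x ∂μ := by
        refine hV.trans (le_of_eq ?_)
        congr 2
        funext x
        refine Finset.sum_congr rfl fun j _ => ?_
        simp only [hind, indicator_apply, mem_ofPred_eq, wordInfo_shiftIter h]
      linarith
    · simp only [Prod.mk.injEq, window_eq_iff] at hxy
      refine (hx.2 y hy.1 fun l h1 h2 => ?_).symm
      rcases lt_or_ge l (-u) with h3 | h3
      · exact (eq_of_revealed_eq hk (hIJ x) hxy.1 l h1 h3).symm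
      · rcases lt_or_ge l 0 with h4 | h4
        · exact (hxy.2.1 l h3 h4).symm
        · exact (hxy.2.2 l h4 h2).symm
  have hsum := Finset.sum_le_sum hphase
  rw [Finset.sum_const, Finset.card_range, nsmul_eq_mul, Finset.sum_add_distrib, Finset.sum_const,
    Finset.card_range, nsmul_eq_mul, ← integral_finsetSum _ fun u _ =>
      integrable_finsetSum _ fun j _ => hindi u j] at hsum
  refine hsum.trans (add_le_add le_rfl ?_)
  set Q := J * k / l + 1 with hQ
  have hQl : J * k ≤ Q * l := by
    have := Nat.lt_div_mul_add (a := J * k) (b := l) (by omega)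
    have h3 : Q * l = J * k / l * l + l := by rw [hQ]; ring
    omega
  have hNi : Integrable (fun x => ((I x + k : ℕ) : ℝ)) μ := by
    simpa using hIi.add (integrable_const (k : ℝ))
  obtain ⟨hbi, hb⟩ := integral_block_le h k Q hl (-(k : ℤ)) (N := fun x => I x + k)
    (hIm.add_const k) hNi
  have hNe : ∫ x, ((I x + k : ℕ) : ℝ) ∂μ = ∫ x, (I x : ℝ) ∂μ + k := by
    push_cast
    rw [integral_add hIi (integrable_const _)]
    simp
  rw [hNe] at hb
  refine le_trans (integral_mono (integrable_finsetSum _ fun u _ =>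
      integrable_finsetSum _ fun j _ => hindi u j) hbi fun x => ?_) hb
  exact sum_phase_le (fun i => wordInfo μ k (shiftIter (-(k : ℤ) - (i : ℤ)) x))
    (fun i => wordInfo_nonneg μ k _) hQl

end RightEstimate

section RightRate

variable {A : Type*} {X : Set (ℤ → A)} {F : (ℤ → A) → (ℤ → A)} {r : ℕ}
  [Fintype A] [MeasurableSpace A]
  {μ : Measure (ℤ → A)} [IsProbabilityMeasure μ]

theorem integral_Iplus_div_mem (hFX : MapsTo F X X) (hF : IsLocal F r) (n : ℕ) :
    (∫ x, (Iplus X F n x : ℝ) ∂μ) / n ∈ Icc (0 : ℝ) r := by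
  refine ⟨div_nonneg (integral_nonneg fun _ => Nat.cast_nonneg _) (Nat.cast_nonneg _), ?_⟩
  refine div_le_of_le_mul₀ (Nat.cast_nonneg _) (Nat.cast_nonneg _) ?_
  have h1 : ∀ x, (Iplus X F n x : ℝ) ≤ r * n := fun x => by exact_mod_cast Iplus_le hFX hF n x
  refine (integral_mono_of_nonneg (Eventually.of_forall fun _ => Nat.cast_nonneg _)
    (integrable_const ((r : ℝ) * n)) (Eventually.of_forall h1)).trans ?_
  simp

theorem avgIplus_nonneg (hFX : MapsTo F X X) (hF : IsLocal F r) : 0 ≤ avgIplus X F μ := by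
  refine le_liminf_of_le ?_ (Eventually.of_forall fun n => (integral_Iplus_div_mem hFX hF n).1)
  exact (isBoundedUnder_of ⟨(r : ℝ), fun n => (integral_Iplus_div_mem (μ := μ) hFX hF n).2⟩ :
    IsBoundedUnder (· ≤ ·) atTop _).isCoboundedUnder_ge

theorem frequently_integral_Iplus_div_lt (hFX : MapsTo F X X) (hF : IsLocal F r) {t : ℝ}
    (ht : 0 < t) :
    ∃ᶠ n : ℕ in atTop, (∫ x, (Iplus X F n x : ℝ) ∂μ) / n < avgIplus X F μ + t := by
  refine frequently_lt_of_liminf_lt ?_ (lt_add_of_pos_right _ ht)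
  exact (isBoundedUnder_of ⟨(r : ℝ), fun n => (integral_Iplus_div_mem (μ := μ) hFX hF n).2⟩ :
    IsBoundedUnder (· ≤ ·) atTop _).isCoboundedUnder_ge

variable [TopologicalSpace A] [DiscreteTopology A] [BorelSpace A]

theorem exists_condEnt_column_le (hX : IsClosed X) (hFX : MapsTo F X X) (hFc : Continuous F)
    (hF : IsLocal F r) (herg : Ergodic (shiftMap A) μ) (hμX : ∀ᵐ x ∂μ, x ∈ X)
    (p : ℕ) {ε : ℝ} (hε : 0 < ε) :
    ∃ n : ℕ, 1 ≤ n ∧ ∃ M : ℕ, condEnt μ (column F p n) (window 0 M) ≤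
      n * ((wordEnt_subadditive μ herg.toMeasurePreserving).lim * avgIplus X F μ + ε) := by
  have h := herg.toMeasurePreserving
  set h0 := (wordEnt_subadditive μ h).lim with hh0
  set I := avgIplus X F μ with hI
  obtain ⟨t, ht0, ht⟩ : ∃ t : ℝ, 0 < t ∧ (h0 + t) * (I + t) < h0 * I + ε / 4 := by
    have hc : Tendsto (fun t : ℝ => (h0 + t) * (I + t)) (𝓝[>] 0) (𝓝 ((h0 + 0) * (I + 0))) :=
      (Continuous.tendsto (by fun_prop) 0).mono_left nhdsWithin_le_nhds
    rw [add_zero, add_zero] at hc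
    have := (tendsto_order.1 hc).2 (h0 * I + ε / 4) (by linarith)
    exact (eventually_mem_nhdsWithin.and this).exists
  have hlim := (wordEnt_subadditive μ h).tendsto_lim (bddBelow_wordEnt_div μ)
  obtain ⟨k, hk1, hkH, hkr⟩ : ∃ k : ℕ, 1 ≤ k ∧ wordEnt μ k / k < h0 + t ∧
      r * Real.log 2 / k < ε / 4 := by
    have h1 := (tendsto_order.1 hlim).2 (h0 + t) (by linarith)
    have h2 := (tendsto_order.1 (tendsto_const_div_atTop_nhds_zero_nat (r * Real.log 2))).2
      (ε / 4) (by linarith)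
    exact ((eventually_ge_atTop 1).and (h1.and h2)).exists
  set δ := ε / (4 * (r + 1)) with hδ
  have hδ0 : 0 < δ := by positivity
  have hδr : r * δ ≤ ε / 4 := by
    rw [hδ, mul_div_assoc', div_le_div_iff₀ (by positivity) (by norm_num)]
    nlinarith
  obtain ⟨l, hl1, hl⟩ : ∃ l : ℕ, 1 ≤ l ∧ infoDev μ k l / l < δ :=
    ((eventually_ge_atTop 1).and ((tendsto_order.1 (tendsto_infoDev herg k)).2 δ hδ0)).exists
  have hk0 : (0 : ℝ) < k := by exact_mod_cast hk1
  have hk1' : (1 : ℝ) ≤ k := by exact_mod_cast hk1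
  have hl0 : (0 : ℝ) < l := by exact_mod_cast hl1
  set c : ℝ := 1 + k * Real.log (Fintype.card A) + Real.log 2 + wordEnt μ k / k * (k + l) +
    (k + l) * δ with hc
  obtain ⟨n, hnI, hn1, hnc⟩ := ((frequently_integral_Iplus_div_lt (μ := μ) hFX hF ht0).and_eventually
    ((eventually_ge_atTop 1).and ((tendsto_order.1 (tendsto_const_div_atTop_nhds_zero_nat c)).2
      (ε / 4) (by linarith)))).exists
  have hn0 : (0 : ℝ) < n := by exact_mod_cast hn1
  obtain ⟨M, hM⟩ := mul_condEnt_column_le hX hFX hFc hF h hμX p n hk1 hl1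
  refine ⟨n, hn1, M, ?_⟩
  set E := condEnt μ (column F p n) (window 0 M)
  set S := ∫ x, (Iplus X F n x : ℝ) ∂μ with hS
  set D := infoDev μ k l
  set H := wordEnt μ k
  have hH0 : 0 ≤ H := wordEnt_nonneg μ k
  have hD0 : 0 ≤ D := infoDev_nonneg μ k l
  have hlog2 : 0 ≤ Real.log 2 := Real.log_nonneg (by norm_num)
  have hS0 : 0 ≤ S := integral_nonneg fun _ => Nat.cast_nonneg _
  rw [div_lt_iff₀ hn0] at hnI hnc
  rw [div_lt_iff₀ hl0] at hl
  have hJ : ((r * n / k + 1 : ℕ) : ℝ) ≤ r * n / k + 1 := by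
    push_cast
    have := Nat.cast_div_le (α := ℝ) (m := r * n) (n := k)
    push_cast at this
    linarith
  have hQ : (((r * n / k + 1) * k / l + 1 : ℕ) : ℝ) ≤ (r * n + k) / l + 1 := by
    have h1 := Nat.cast_div_le (α := ℝ) (m := (r * n / k + 1) * k) (n := l)
    have h2 : (((r * n / k + 1) * k : ℕ) : ℝ) ≤ r * n + k := by
      have := Nat.div_mul_le_self (r * n) k
      have h3 : (r * n / k + 1) * k ≤ r * n + k := by nlinarith
      exact_mod_cast h3
    push_cast at h1 h2 ⊢
    have h3 := div_le_div_of_nonneg_right h2 hl0.le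
    linarith
  have hQD : (((r * n / k + 1) * k / l + 1 : ℕ) : ℝ) * D ≤ (r * n + k + l) * δ := by
    calc _ ≤ ((r * n + k) / l + 1) * (δ * l) :=
          mul_le_mul hQ hl.le hD0 (by positivity)
      _ = _ := by field_simp
  have hJ2 := mul_le_mul_of_nonneg_right hJ hlog2
  have hmain : k * E ≤ k * (1 + k * Real.log (Fintype.card A) + (r * n / k + 1) * Real.log 2) +
      (H * (S + k + l) + (r * n + k + l) * δ) := by
    refine hM.trans (add_le_add (mul_le_mul_of_nonneg_left ?_ hk0.le) (add_le_add le_rfl hQD))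
    linarith
  have hE : E ≤ 1 + k * Real.log (Fintype.card A) + (r * n / k + 1) * Real.log 2 +
      (H / k * (S + k + l) + (r * n + k + l) * δ) := by
    refine le_of_mul_le_mul_left (hmain.trans ?_) hk0
    rw [mul_add (k : ℝ) _ (_ + _)]
    refine add_le_add le_rfl ?_
    rw [mul_add (k : ℝ) (H / k * _)]
    refine add_le_add (le_of_eq (by field_simp)) (le_mul_of_one_le_left (by positivity) hk1')
  have e1 : r * n / k * Real.log 2 ≤ n * (ε / 4) := by
    calc (r * n / k * Real.log 2 : ℝ) = n * (r * Real.log 2 / k) := by ring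
      _ ≤ _ := mul_le_mul_of_nonneg_left hkr.le hn0.le
  have e2 : H / k * S ≤ n * (h0 * I + ε / 4) := by
    calc H / k * S ≤ (h0 + t) * ((I + t) * n) :=
          mul_le_mul hkH.le hnI.le hS0 ((div_nonneg hH0 hk0.le).trans hkH.le)
      _ = n * ((h0 + t) * (I + t)) := by ring
      _ ≤ _ := mul_le_mul_of_nonneg_left ht.le hn0.le
  have e3 : r * n * δ ≤ n * (ε / 4) := by nlinarith
  have e4 : E ≤ c + r * n / k * Real.log 2 + H / k * S + r * n * δ := by
    rw [hc]; linarith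
  linarith

end RightRate

section Columns

variable {A : Type*} {X : Set (ℤ → A)} {F : (ℤ → A) → (ℤ → A)} {r : ℕ}

theorem IsLocal.agree_of_column_eq (hF : IsLocal F r) {p n : ℕ} (hp : r ≤ p) {L : ℤ} {x y : ℤ → A}
    (hc : column F p n x = column F p n y) (hxy : ∀ j, 0 ≤ j → j < L → x j = y j) {i : ℕ}
    (hi : i ≤ n) (j : ℤ) (h0 : 0 ≤ j) (h1 : j < L - r * i) : F^[i] x j = F^[i] y j := by
  induction i generalizing j with
  | zero => exact hxy j h0 (by simpa using h1)
  | succ i ih =>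
    rcases lt_or_ge j p with hj | hj
    · exact window_eq_iff.1 (congrFun hc ⟨i + 1, by omega⟩) j h0 hj
    · rw [Function.iterate_succ_apply', Function.iterate_succ_apply']
      refine hF _ _ _ fun l h2 h3 => ih (by omega) l (by omega) ?_
      push_cast at h1
      linarith

variable [Fintype A] [TopologicalSpace A] [DiscreteTopology A] [MeasurableSpace A] [BorelSpace A]
  {μ : Measure (ℤ → A)} [IsProbabilityMeasure μ]

theorem condEnt_column_add_le (hFc : Continuous F) (hF : IsLocal F r)
    (hinv : MeasurePreserving F μ μ) {p : ℕ} (hp : r ≤ p) (n m : ℕ) (L : ℤ) :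
    condEnt μ (column F p (n + m)) (window 0 L) ≤ condEnt μ (column F p n) (window 0 L) +
      condEnt μ (column F p m) (window 0 (L - r * n)) := by
  have hm : FiberMeas fun x => column F p m (F^[n] x) :=
    (fiberMeas_column hFc p m).comp_measurable (hinv.iterate n).measurable
  have hn := fiberMeas_column hFc p n
  have hR := fiberMeas_window (A := A) 0 L
  rw [← condEnt_comp μ (fiberMeas_column hFc p m) (fiberMeas_window 0 (L - r * n))
    (hinv.iterate n)]
  refine (condEnt_le_of_determines_left μ (hn.prodMk hm) hR fun x y h => ?_).trans
    ((condEnt_chain μ hn hm hR).le.trans (add_le_add le_rfl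
      (condEnt_le_of_determines_right μ hm (hn.prodMk hR) fun x y h => ?_)))
  · simp only [Prod.mk.injEq] at h
    funext i
    rcases le_or_gt (i : ℕ) n with hi | hi
    · exact congrFun h.1.1 ⟨i, by omega⟩
    · have := congrFun h.1.2 ⟨i - n, by omega⟩
      simp only [column, ← Function.iterate_add_apply] at this
      rwa [Nat.sub_add_cancel hi.le] at this
  · simp only [Prod.mk.injEq, window_eq_iff] at h
    rw [window_eq_iff]
    exact hF.agree_of_column_eq hp h.1 h.2 le_rfl

theorem condEnt_column_mul_le (hFc : Continuous F) (hF : IsLocal F r)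
    (hinv : MeasurePreserving F μ μ) {p : ℕ} (hp : r ≤ p) (n M : ℕ) {q : ℕ} (hq : 1 ≤ q) {L : ℤ}
    (hL : (r * (q * n) + M : ℕ) ≤ L) :
    condEnt μ (column F p (q * n)) (window 0 L) ≤
      q * condEnt μ (column F p n) (window 0 M) := by
  have hmono : ∀ L : ℤ, M ≤ L → condEnt μ (column F p n) (window 0 L) ≤
      condEnt μ (column F p n) (window 0 M) := fun L hL =>
    condEnt_le_of_determines_right μ (fiberMeas_column hFc p n) (fiberMeas_window 0 L)
      fun x y h => by
        rw [window_eq_iff] at h ⊢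
        exact fun i h1 h2 => h i h1 (by omega)
  induction q, hq using Nat.le_induction generalizing L with
  | base =>
    rw [one_mul, Nat.cast_one, one_mul]
    exact hmono L (by push_cast at hL; nlinarith [Nat.zero_le (r * n)])
  | succ q hq ih =>
    rw [show (q + 1) * n = n + q * n by ring] at hL ⊢
    refine (condEnt_column_add_le hFc hF hinv hp n (q * n) L).trans ?_
    have h1 := ih (L := L - r * n) (by push_cast at hL ⊢; linarith)
    have h2 := hmono L (by
      push_cast at hL
      have : (0 : ℤ) ≤ r * (n + q * n) := by positivity
      linarith)
    push_cast
    linarith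

theorem exists_condEnt_column_right_le (hX : IsClosed X) (hFX : MapsTo F X X) (hFc : Continuous F)
    (hF : IsLocal F r) (herg : Ergodic (shiftMap A) μ) (hinv : MeasurePreserving F μ μ)
    (hμX : ∀ᵐ x ∂μ, x ∈ X) {p : ℕ} (hp : r ≤ p) {ε : ℝ} (hε : 0 < ε) :
    ∃ n : ℕ, 1 ≤ n ∧ ∃ M : ℕ, ∀ q : ℕ, 1 ≤ q → ∀ L : ℤ, (r * (q * n) + M : ℕ) ≤ L →
      condEnt μ (column F p (q * n)) (window 0 L) ≤ q * (n *
        ((wordEnt_subadditive μ herg.toMeasurePreserving).lim * avgIplus X F μ + ε)) := by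
  obtain ⟨n, hn, M, hM⟩ := exists_condEnt_column_le hX hFX hFc hF herg hμX p hε
  exact ⟨n, hn, M, fun q hq L hL => (condEnt_column_mul_le hFc hF hinv hp n M hq hL).trans
    (mul_le_mul_of_nonneg_left hM (Nat.cast_nonneg q))⟩

end Columns

section Reflection

variable {A : Type*}

/-- The reflection `x ↦ (x_{-i})_i`. -/
def reflect (x : ℤ → A) : ℤ → A := fun i => x (-i)

theorem reflect_reflect (x : ℤ → A) : reflect (reflect x) = x := by
  funext i; simp [reflect]

variable {X : Set (ℤ → A)} {F : (ℤ → A) → (ℤ → A)} {r : ℕ}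

/-- The conjugate of `F` by the reflection. -/
def reflectMap (F : (ℤ → A) → (ℤ → A)) (x : ℤ → A) : ℤ → A := reflect (F (reflect x))

theorem reflectMap_iterate (n : ℕ) (x : ℤ → A) :
    (reflectMap F)^[n] (reflect x) = reflect (F^[n] x) := by
  have : Function.Semiconj reflect F (reflectMap F) := fun x => by
    rw [reflectMap, reflect_reflect]
  exact ((this.iterate_right n) x).symm

theorem IsLocal.reflectMap (hF : IsLocal F r) : IsLocal (reflectMap F) r := by
  intro x y i h
  refine hF _ _ _ fun j h1 h2 => h _ ?_ ?_ <;> omega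

theorem Iplus_reflect (n : ℕ) (x : ℤ → A) :
    Iplus (reflect ⁻¹' X) (reflectMap F) n (reflect x) = Iminus X F n x := by
  have hW : ∀ (s t : ℤ) (z y : ℤ → A), t = -s →
      (reflect y ∈ Wplus (reflect ⁻¹' X) t (reflect z) ↔ y ∈ Wminus X s z) := by
    rintro s _ z y rfl
    simp only [Wplus, Wminus, mem_ofPred_eq, mem_preimage, reflect_reflect]
    refine and_congr_right fun _ => ⟨fun h i hi => ?_, fun h i hi => h _ (by omega)⟩
    simpa [reflect] using h (-i) (by omega)
  unfold Iplus Iminus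
  congr 1
  ext s
  simp only [mem_ofPred_eq, image_subset_iff]
  refine forall_congr' fun i => forall_congr' fun _ => forall_congr' fun _ => ?_
  constructor
  · intro h y hy
    have h1 := h ((hW s _ x y rfl).2 hy)
    rw [mem_preimage, reflectMap_iterate, reflectMap_iterate, hW 0 _ _ _ (by simp)] at h1
    exact h1
  · intro h y hy
    rw [← reflect_reflect y] at hy ⊢
    have h1 := h ((hW s _ x _ rfl).1 hy)
    rw [mem_preimage, reflectMap_iterate, reflectMap_iterate, hW 0 _ _ _ (by simp)]
    exact h1

variable [MeasurableSpace A]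

theorem measurable_reflect : Measurable (reflect : (ℤ → A) → _) :=
  measurable_pi_lambda _ fun _ => measurable_pi_apply _

/-- The reflection as a measurable equivalence. -/
def reflectEquiv (A : Type*) [MeasurableSpace A] : (ℤ → A) ≃ᵐ (ℤ → A) where
  toFun := reflect
  invFun := reflect
  left_inv := reflect_reflect
  right_inv := reflect_reflect
  measurable_toFun := measurable_reflect
  measurable_invFun := measurable_reflect

theorem avgIplus_reflect (μ : Measure (ℤ → A)) :
    avgIplus (reflect ⁻¹' X) (reflectMap F) (μ.map reflect) = avgIminus X F μ := by
  unfold avgIplus avgIminus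
  congr 1
  funext n
  congr 1
  have := (reflectEquiv A).measurableEmbedding.integral_map (μ := μ)
    fun x => (Iplus (reflect ⁻¹' X) (reflectMap F) n x : ℝ)
  refine this.trans (integral_congr_ae (Eventually.of_forall fun x => ?_))
  exact congrArg _ (Iplus_reflect n x)

theorem measurePreserving_reflect (μ : Measure (ℤ → A)) :
    MeasurePreserving reflect μ (μ.map reflect) := ⟨measurable_reflect, rfl⟩

theorem ergodic_shiftMap_map_reflect {μ : Measure (ℤ → A)} (h : Ergodic (shiftMap A) μ) :
    Ergodic (shiftMap A) (μ.map reflect) := by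
  have h1 : Ergodic (shiftEquiv A).symm μ := Ergodic.symm (e := shiftEquiv A) h
  refine (measurePreserving_reflect μ).ergodic_of_ergodic_semiconj h1
    (shiftEquiv A).measurable fun x => ?_
  funext i
  simp only [shiftMap, reflect]
  change x (-i + -1) = _
  rw [neg_add]

theorem measurePreserving_reflectMap {μ : Measure (ℤ → A)} (h : MeasurePreserving F μ μ) :
    MeasurePreserving (reflectMap F) (μ.map reflect) (μ.map reflect) := by
  refine (measurePreserving_reflect μ).of_semiconj h (fun x => ?_)
    (measurable_reflect.comp (h.measurable.comp measurable_reflect))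
  rw [reflectMap, reflect_reflect]

variable [Fintype A] [MeasurableSingletonClass A]

theorem wordEnt_map_reflect {μ : Measure (ℤ → A)} [IsProbabilityMeasure μ]
    (h : MeasurePreserving (shiftMap A) μ μ) : wordEnt (μ.map reflect) = wordEnt μ := by
  funext n
  rw [wordEnt, ← partEnt_comp μ (fiberMeas_prefixWord n) (measurePreserving_reflect μ),
    ← partEnt_window μ h (a := 1 - n) (b := 1) (n := n) (by ring)]
  refine partEnt_congr μ (fiberMeas_window' _ _) (fun x y hxy => ?_) (fun x y hxy => ?_)
  · rw [window_eq_iff] at hxy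
    exact funext fun i => hxy _ (by have := i.2; omega) (by omega)
  · rw [window_eq_iff]
    intro i h1 h2
    have h3 := congrFun hxy ⟨(-i).toNat, by omega⟩
    simp only [prefixWord, reflect] at h3
    rwa [show -(((-i).toNat : ℕ) : ℤ) = i by omega] at h3

end Reflection

section Left

variable {A : Type*} {X : Set (ℤ → A)} {F : (ℤ → A) → (ℤ → A)} {r : ℕ}

theorem HasLocalRule.iterate_shiftIter (h : HasLocalRule F r) (n : ℕ) (j : ℤ) (x : ℤ → A) :
    F^[n] (shiftIter j x) = shiftIter j (F^[n] x) := by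
  obtain ⟨f, hf⟩ := h
  have : Function.Semiconj (shiftIter j) F F := fun x => by
    funext i
    rw [hf]
    simp only [shiftIter]
    rw [hf]
    congr 1
    funext l
    congr 1
    ring
  exact (this.iterate_right n x).symm

variable [Fintype A] [TopologicalSpace A] [DiscreteTopology A] [MeasurableSpace A] [BorelSpace A]
  {μ : Measure (ℤ → A)} [IsProbabilityMeasure μ]

theorem continuous_reflect : Continuous (reflect : (ℤ → A) → _) :=
  continuous_pi fun _ => continuous_apply _

theorem exists_condEnt_column_left_le (hX : IsClosed X) (hFX : MapsTo F X X) (hFc : Continuous F)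
    (hF : HasLocalRule F r) (herg : Ergodic (shiftMap A) μ) (hinv : MeasurePreserving F μ μ)
    (hμX : ∀ᵐ x ∂μ, x ∈ X) {p : ℕ} (hp : r ≤ p) {ε : ℝ} (hε : 0 < ε) :
    ∃ n : ℕ, 1 ≤ n ∧ ∃ M : ℕ, ∀ q : ℕ, 1 ≤ q → ∀ L : ℤ, (r * (q * n) + M : ℕ) ≤ L →
      condEnt μ (column F p (q * n)) (window (p - L) p) ≤ q * (n *
        ((wordEnt_subadditive μ herg.toMeasurePreserving).lim * avgIminus X F μ + ε)) := by
  have hR := measurePreserving_reflect μ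
  have : IsProbabilityMeasure (μ.map reflect) :=
    Measure.isProbabilityMeasure_map measurable_reflect.aemeasurable
  have hFX' : MapsTo (reflectMap F) (reflect ⁻¹' X) (reflect ⁻¹' X) := fun x hx => by
    rw [mem_preimage, reflectMap, reflect_reflect]
    exact hFX hx
  have hFc' : Continuous (reflectMap F) :=
    continuous_reflect.comp (hFc.comp continuous_reflect)
  have hμX' : ∀ᵐ x ∂μ.map reflect, x ∈ reflect ⁻¹' X :=
    (ae_map_iff hR.measurable.aemeasurable (measurable_reflect hX.measurableSet)).2
      (by simpa only [mem_preimage, reflect_reflect] using hμX)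
  obtain ⟨n, hn, M, hM⟩ := exists_condEnt_column_right_le (hX.preimage continuous_reflect) hFX'
    hFc' hF.isLocal.reflectMap (ergodic_shiftMap_map_reflect herg)
    (measurePreserving_reflectMap hinv) hμX' hp hε
  refine ⟨n, hn, M, fun q hq L hL => ?_⟩
  have h1 := hM q hq L hL
  have hlim : (wordEnt_subadditive (μ.map reflect)
      (ergodic_shiftMap_map_reflect herg).toMeasurePreserving).lim =
      (wordEnt_subadditive μ herg.toMeasurePreserving).lim := by
    unfold Subadditive.lim
    rw [wordEnt_map_reflect herg.toMeasurePreserving]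
  rw [avgIplus_reflect, hlim, ← condEnt_comp μ (fiberMeas_column hFc' p (q * n))
    (fiberMeas_window 0 L)
    (hR.comp (measurePreserving_shiftIter herg.toMeasurePreserving (p - 1)))] at h1
  have hf := (hR.comp (measurePreserving_shiftIter herg.toMeasurePreserving (p - 1))).measurable
  have hC := (fiberMeas_column hFc' p (q * n)).comp_measurable hf
  refine (condEnt_le_of_determines_left μ hC (fiberMeas_window _ _) fun x y h => ?_).trans
    ((condEnt_le_of_determines_right μ hC (fiberMeas_window _ _) fun x y h => ?_).trans h1)
  · have h2 := (Prod.ext_iff.1 h).1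
    funext i
    have h3 := congrFun h2 i
    simp only [column, Function.comp_apply, reflectMap_iterate, hF.iterate_shiftIter] at h3 ⊢
    rw [window_eq_iff] at h3 ⊢
    intro j hj0 hj1
    have h4 := h3 (p - 1 - j) (by omega) (by omega)
    simp only [reflect, shiftIter] at h4
    rwa [show -((p : ℤ) - 1 - j) + (p - 1) = j by ring] at h4
  · rw [window_eq_iff] at h ⊢
    intro j hj0 hj1
    exact h _ (by omega) (by omega)

end Left

section Assembly

theorem partEnt_le_condEnt_add_condEnt {Ω S T R : Type*} [MeasurableSpace Ω] [Fintype S]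
    [Fintype T] [Fintype R] (μ : Measure Ω) [IsProbabilityMeasure μ] {α : Ω → S} {β : Ω → T}
    {γ : Ω → R} (hα : FiberMeas α) (hβ : FiberMeas β) (hγ : FiberMeas γ) :
    partEnt μ α ≤ condEnt μ α β + condEnt μ α γ +
      (partEnt μ β + partEnt μ γ - partEnt μ fun x => (β x, γ x)) := by
  have h1 := partEnt_submodular μ hβ hγ hα
  have h2 : partEnt μ (fun x => (β x, γ x)) ≤ partEnt μ (fun x => (β x, γ x, α x)) :=
    partEnt_le_of_determines μ (hβ.prodMk (hγ.prodMk hα)) fun x y h => by simp_all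
  have h3 : partEnt μ (fun x => (β x, α x)) = partEnt μ (fun x => (α x, β x)) :=
    partEnt_congr μ (hα.prodMk hβ) (fun x y h => by simp_all) fun x y h => by simp_all
  have h4 : partEnt μ (fun x => (γ x, α x)) = partEnt μ (fun x => (α x, γ x)) :=
    partEnt_congr μ (hα.prodMk hγ) (fun x y h => by simp_all) fun x y h => by simp_all
  unfold condEnt
  linarith

variable {A : Type*} {X : Set (ℤ → A)} {F : (ℤ → A) → (ℤ → A)} {r : ℕ}

variable [Fintype A] [TopologicalSpace A] [DiscreteTopology A] [MeasurableSpace A] [BorelSpace A]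
  {μ : Measure (ℤ → A)} [IsProbabilityMeasure μ]

theorem avgIminus_nonneg (hFX : MapsTo F X X) (hF : IsLocal F r) : 0 ≤ avgIminus X F μ := by
  have : IsProbabilityMeasure (μ.map reflect) :=
    Measure.isProbabilityMeasure_map measurable_reflect.aemeasurable
  rw [← avgIplus_reflect]
  refine avgIplus_nonneg (fun x hx => ?_) hF.reflectMap
  rw [mem_preimage, reflectMap, reflect_reflect]
  exact hFX hx

theorem lim_wordEnt_nonneg (h : MeasurePreserving (shiftMap A) μ μ) :
    0 ≤ (wordEnt_subadditive μ h).lim :=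
  ge_of_tendsto' ((wordEnt_subadditive μ h).tendsto_lim (bddBelow_wordEnt_div μ)) fun n =>
    div_nonneg (wordEnt_nonneg μ n) n.cast_nonneg

/-- The mutual information of two windows of length `L` overlapping in `p` coordinates. -/
theorem window_mutual_le (h : MeasurePreserving (shiftMap A) μ μ) {p L : ℕ} (hL : p ≤ L) :
    partEnt μ (window 0 L) + partEnt μ (window (p - L : ℤ) p) -
      partEnt μ (fun x : ℤ → A => (window 0 (L : ℤ) x, window (p - L : ℤ) p x)) ≤
      2 * wordEnt μ L - (2 * L - p) * (wordEnt_subadditive μ h).lim := by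
  have h1 : partEnt μ (window (p - L : ℤ) L) ≤
      partEnt μ (fun x : ℤ → A => (window 0 (L : ℤ) x, window (p - L : ℤ) p x)) :=
    partEnt_le_of_determines μ ((fiberMeas_window _ _).prodMk (fiberMeas_window _ _))
      fun x y hxy => by
        simp only [Prod.mk.injEq, window_eq_iff] at hxy ⊢
        intro i h1 h2
        rcases lt_or_ge i 0 with h3 | h3
        · exact hxy.2 i h1 (by omega)
        · exact hxy.1 i h3 h2
  rw [partEnt_window μ h (n := 2 * L - p) (by omega)] at h1
  rw [partEnt_window μ h (n := L) (by simp), partEnt_window μ h (n := L) (by simp)]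
  have h2 : (2 * L - p) * (wordEnt_subadditive μ h).lim ≤ wordEnt μ (2 * L - p) := by
    have e : ((2 * L - p : ℕ) : ℝ) = 2 * L - p := by
      rw [Nat.cast_sub (by omega)]; simp
    rw [← e]
    rcases Nat.eq_zero_or_pos (2 * L - p) with h0 | h0
    · rw [h0, Nat.cast_zero, zero_mul]
      exact wordEnt_nonneg μ 0
    · have := (wordEnt_subadditive μ h).lim_le_div (bddBelow_wordEnt_div μ) h0.ne'
      rw [le_div_iff₀ (by exact_mod_cast h0)] at this
      linarith
  linarith

theorem exists_partEnt_column_le (hX : IsClosed X) (hFX : MapsTo F X X) (hFc : Continuous F)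
    (hF : HasLocalRule F r) (herg : Ergodic (shiftMap A) μ) (hinv : MeasurePreserving F μ μ)
    (hμX : ∀ᵐ x ∂μ, x ∈ X) {p : ℕ} (hp : r ≤ p) {ε : ℝ} (hε : 0 < ε) :
    ∃ n : ℕ, partEnt μ (column F p n) ≤ (n + 1) *
      ((wordEnt_subadditive μ herg.toMeasurePreserving).lim *
        (avgIplus X F μ + avgIminus X F μ) + ε) := by
  have hε3 : 0 < ε / 3 := by positivity
  have hσ := herg.toMeasurePreserving
  obtain ⟨n₀, hn₀, M₀, h₀⟩ := exists_condEnt_column_right_le hX hFX hFc hF.isLocal herg hinv hμX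
    hp hε3
  obtain ⟨n₁, hn₁, M₁, h₁⟩ := exists_condEnt_column_left_le hX hFX hFc hF herg hinv hμX hp hε3
  have hIp := avgIplus_nonneg (μ := μ) hFX hF.isLocal
  have hIm := avgIminus_nonneg (μ := μ) hFX hF.isLocal
  have hh := lim_wordEnt_nonneg hσ
  set h := (wordEnt_subadditive μ hσ).lim with hh_def
  set δ : ℝ := ε / (12 * (r + 1)) with hδ
  have hδ0 : 0 < δ := by positivity
  have hδr : 2 * δ * r ≤ ε / 6 := by
    rw [hδ, mul_div_assoc', div_mul_eq_mul_div, div_le_iff₀ (by positivity)]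
    nlinarith
  set K : ℕ := M₀ + M₁ + p with hK
  obtain ⟨L₀, hL₀⟩ := eventually_atTop.1
    (((wordEnt_subadditive μ hσ).tendsto_lim (bddBelow_wordEnt_div μ)).eventually_lt_const
      (lt_add_of_pos_right h hδ0))
  obtain ⟨q, hq⟩ := exists_nat_gt (max 1 ((2 * (K + L₀ + 1) * δ + p * h) / (ε / 6)))
  have hq1 : 1 ≤ q := by
    have := (le_max_left _ _).trans_lt hq
    exact_mod_cast this.le
  have hq2 : 2 * (K + L₀ + 1) * δ + p * h ≤ ε / 6 * q := by
    have := ((le_max_right _ _).trans_lt hq).le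
    rw [div_le_iff₀ (by positivity)] at this
    linarith
  set N : ℕ := q * (n₀ * n₁) with hN
  set L : ℕ := r * N + K + L₀ + 1 with hL
  have hqN : q ≤ N := Nat.le_mul_of_pos_right q (Nat.mul_pos hn₀ hn₁)
  have a₀ := h₀ (q * n₁) (Nat.mul_pos hq1 hn₁) L (by
    rw [show q * n₁ * n₀ = N by rw [hN]; ring]
    exact_mod_cast (by omega : r * N + M₀ ≤ L))
  have a₁ := h₁ (q * n₀) (Nat.mul_pos hq1 hn₀) L (by
    rw [show q * n₀ * n₁ = N by rw [hN]; ring]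
    exact_mod_cast (by omega : r * N + M₁ ≤ L))
  rw [show q * n₁ * n₀ = N by rw [hN]; ring] at a₀
  rw [show q * n₀ * n₁ = N by rw [hN]; ring] at a₁
  have b := partEnt_le_condEnt_add_condEnt μ (fiberMeas_column hFc p N)
    (fiberMeas_window (A := A) 0 L) (fiberMeas_window (p - L : ℤ) p)
  have c := window_mutual_le (μ := μ) hσ (show p ≤ L by omega)
  have d := hL₀ L (by omega)
  rw [div_lt_iff₀ (by exact_mod_cast (by omega : 0 < L))] at d
  have eN : (N : ℝ) = q * n₁ * n₀ := by rw [hN]; push_cast; ring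
  have eL : (L : ℝ) = r * N + K + L₀ + 1 := by rw [hL]; push_cast; ring
  refine ⟨N, ?_⟩
  have hqN' : (q : ℝ) ≤ N := by exact_mod_cast hqN
  have e₀ : ((q * n₁ : ℕ) : ℝ) * (n₀ * (h * avgIplus X F μ + ε / 3)) =
      N * (h * avgIplus X F μ + ε / 3) := by rw [eN]; push_cast; ring
  have e₁ : ((q * n₀ : ℕ) : ℝ) * (n₁ * (h * avgIminus X F μ + ε / 3)) =
      N * (h * avgIminus X F μ + ε / 3) := by rw [eN]; push_cast; ring
  rw [e₀] at a₀
  rw [e₁] at a₁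
  have f : 2 * δ * L + p * h ≤ ε / 3 * N := by
    have f₁ : 2 * δ * r * N ≤ ε / 6 * N := mul_le_mul_of_nonneg_right hδr N.cast_nonneg
    have f₂ : ε / 6 * q ≤ ε / 6 * N := mul_le_mul_of_nonneg_left hqN' (by positivity)
    rw [eL]
    linarith
  have g : 0 ≤ h * (avgIplus X F μ + avgIminus X F μ) + ε := by positivity
  linarith

theorem entropyPart_le_lim_mul (hX : IsClosed X) (hFX : MapsTo F X X) (hFc : Continuous F)
    (hF : HasLocalRule F r) (herg : Ergodic (shiftMap A) μ) (hinv : MeasurePreserving F μ μ)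
    (hμX : ∀ᵐ x ∂μ, x ∈ X) {k : ℕ} {β : (ℤ → A) → Fin k} (hβ : Measurable β) :
    entropyPart μ F β ≤ (wordEnt_subadditive μ herg.toMeasurePreserving).lim *
      (avgIplus X F μ + avgIminus X F μ) := by
  refine entropyPart_le_of_window μ hinv (fun p ε hε => ?_) hβ
  obtain ⟨n, hn⟩ := exists_partEnt_column_le hX hFX hFc hF herg hinv hμX
    (p := max (2 * p) r) (le_max_right _ _) hε
  refine ⟨n, le_trans ?_ hn⟩
  have hs := measurePreserving_shiftIter herg.toMeasurePreserving (-p : ℤ)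
  have hC := fiberMeas_column (A := A) hFc (max (2 * p) r) n
  rw [← partEnt_comp μ hC hs]
  refine partEnt_le_of_determines μ (hC.comp_measurable hs.measurable) fun x y h => ?_
  funext i
  have h1 := congrFun h i
  simp only [column, hF.iterate_shiftIter] at h1
  rw [window_eq_iff] at h1 ⊢
  intro j h2 h3
  have h4 := h1 (j + p) (by omega) (by omega)
  simpa [shiftIter] using h4

theorem ae_mem_of_msupp_subset (h : msupp μ ⊆ X) : ∀ᵐ x ∂μ, x ∈ X := by
  refine measure_mono_null (compl_subset_compl.2 h) (measure_null_of_locally_null _ fun x hx => ?_)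
  simp only [msupp, mem_compl_iff, mem_ofPred_eq, not_forall, not_lt, nonpos_iff_eq_zero] at hx
  obtain ⟨U, hU, hxU, hμU⟩ := hx
  exact ⟨U, mem_nhdsWithin_of_mem_nhds (hU.mem_nhds hxU), hμU⟩

end Assembly

/-- Main theorem: for a `σ`-ergodic and `F`-invariant measure `μ`,
`h_μ(F) ≤ h_μ(σ) · (I_μ⁺ + I_μ⁻)`. -/
theorem stmt11 {A : Type*} [Fintype A] [TopologicalSpace A] [DiscreteTopology A]
    [MeasurableSpace A] [BorelSpace A]
    (X : Set (ℤ → A)) (hXcl : IsClosed X) (hXσ : shiftMap A '' X = X)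
    (F : (ℤ → A) → (ℤ → A)) (hFX : Set.MapsTo F X X) (hFc : Continuous F)
    (hFσ : ∀ x, F (shiftMap A x) = shiftMap A (F x))
    (r : ℕ) (hr : 1 ≤ r) (hloc : HasLocalRule F r)
    (μ : Measure (ℤ → A)) [IsProbabilityMeasure μ]
    (herg : Ergodic (shiftMap A) μ) (hFinv : MeasurePreserving F μ μ)
    (hsuppX : msupp μ ⊆ X) :
    metricEntropy μ F ≤ metricEntropy μ (shiftMap A) * (avgIplus X F μ + avgIminus X F μ) := by
  have hp := avgIplus_nonneg (μ := μ) hFX hloc.isLocal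
  have hm := avgIminus_nonneg (μ := μ) hFX hloc.isLocal
  have : Nonempty {q : Σ k : ℕ, (ℤ → A) → Fin k // Measurable q.2} :=
    ⟨⟨⟨1, fun _ => 0⟩, measurable_const⟩⟩
  refine (ciSup_le fun q => entropyPart_le_lim_mul hXcl hFX hFc hloc herg hFinv
    (ae_mem_of_msupp_subset hsuppX) q.2).trans ?_
  exact mul_le_mul_of_nonneg_right (lim_wordEnt_le_metricEntropy μ herg.toMeasurePreserving)
    (add_nonneg hp hm)
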